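/- Let a(n) (n a nonnegative integer) be the Fourier coefficients of φ(τ) := (1/2)·( η_g(τ/2)/η_g(τ) − η_{−g}(τ/2)/η_{−g}(τ) + 729·η_g(τ) + η_{−g}(τ) ), i.e. φ(τ) = ∑_{n≥0} a(n) q^n with absolute convergence, where η_g(τ) = η(3τ)^{12}/η(τ)^{12} and η_{−g}(τ) = η(τ)^{12} η(6τ)^{12}/(η(2τ)^{12} η(3τ)^{12}). For integers n ≥ 0 and k ∈ {0,1,2}, set ê(n,k) := (1/3)·( −24·[n = 0] + (3·[k = 0] − 1)·a(n) ), where [·] is 1 if the condition holds and 0 otherwise. Then there exists Y > 0 such that for all σ, τ in the upper half-plane with Im σ > Y and Im τ > Y, the product converges absolutely and p^{-1} · ∏_{d=1}^∞ ∏_{k=0}^{2} ∏_{r=0}^∞ (1 − exp(2πik/3)·p^d·q^r)^{ê(rd,k)} = η(σ)^{12}/η(3σ)^{12} + 12 − φ(τ), where for a possibly non-integer exponent β one sets w^β := exp(β·Log w) with the principal logarithm. (This is the g-twisted superdenominator identity of the Conway Borcherds–Kac–Moody superalgebra for the class 3A of Co₀.) -/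

import Mathlib

open scoped Real

/-- The Dedekind eta function `η(τ) = e^{πiτ/12} ∏_{n=1}^∞ (1 - e^{2πinτ})`. -/
noncomputable def eta (τ : ℂ) : ℂ :=
  Complex.exp (Real.pi * Complex.I * τ / 12) *
    ∏' n : ℕ, (1 - Complex.exp (2 * Real.pi * Complex.I * (n + 1) * τ))

/-- The eta product `η_g(τ) = η(3τ)^{12}/η(τ)^{12}` for the class 3A (Frame shape 3¹²/1¹²). -/
noncomputable def etaG3A (τ : ℂ) : ℂ := eta (3 * τ) ^ 12 / eta τ ^ 12

/-- The dual eta product `η_{−g}(τ) = η(τ)^{12} η(6τ)^{12}/(η(2τ)^{12} η(3τ)^{12})`. -/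
noncomputable def etaMG3A (τ : ℂ) : ℂ :=
  eta τ ^ 12 * eta (6 * τ) ^ 12 / (eta (2 * τ) ^ 12 * eta (3 * τ) ^ 12)

/-- `φ(τ) = f_{3A}(0,0;τ) = ½(η_g(τ/2)/η_g(τ) − η_{−g}(τ/2)/η_{−g}(τ) + 729 η_g(τ) + η_{−g}(τ))`. -/
noncomputable def phi3A (τ : ℂ) : ℂ :=
  (1 / 2) * (etaG3A (τ / 2) / etaG3A τ - etaMG3A (τ / 2) / etaMG3A τ
    + 729 * etaG3A τ + etaMG3A τ)

/-- `ê(n,k) = (1/3)(−24·[n=0] + (3·[k=0] − 1)·a(n))`. -/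
noncomputable def ehat3A (a : ℕ → ℂ) (n : ℕ) (k : Fin 3) : ℂ :=
  (1 / 3) * ((-24) * (if n = 0 then 1 else 0) + (3 * (if k = 0 then 1 else 0) - 1) * a n)

namespace C3A
open Filter Topology

/-- The nome. -/
noncomputable def nome (τ : ℂ) : ℂ := Complex.exp (2 * Real.pi * Complex.I * τ)

/-- The Euler function. -/
noncomputable def gE (x : ℂ) : ℂ := ∏' n : ℕ, (1 - x ^ (n + 1))

lemma eta_eq (τ : ℂ) : eta τ = ModularForm.eta τ := by
  unfold eta ModularForm.eta
  congr 1
  · unfold Function.Periodic.qParam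
    congr 1
    push_cast
    ring
  · refine tprod_congr fun n => ?_
    rw [ModularForm.eta_q_eq_cexp]

lemma eta_eq_gE (τ : ℂ) : eta τ = Complex.exp (Real.pi * Complex.I * τ / 12) * gE (nome τ) := by
  unfold eta gE nome
  congr 1
  refine tprod_congr fun n => ?_
  rw [← Complex.exp_nat_mul]
  push_cast
  congr 2
  ring

lemma nome_ne (τ : ℂ) : nome τ ≠ 0 := Complex.exp_ne_zero _

lemma norm_nome (τ : ℂ) : ‖nome τ‖ = Real.exp (-(2 * Real.pi * τ.im)) := by
  unfold nome
  rw [Complex.norm_exp]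
  simp

lemma norm_nome_lt {τ : ℂ} (h : 0 < τ.im) : ‖nome τ‖ < 1 := by
  rw [norm_nome, Real.exp_lt_one_iff]
  have := Real.pi_pos
  have : 0 < 2 * Real.pi * τ.im := by positivity
  linarith

lemma nome_mul (n : ℕ) (τ : ℂ) : nome (n * τ) = nome τ ^ n := by
  unfold nome
  rw [← Complex.exp_nat_mul]
  congr 1
  ring

lemma nome_add (a b : ℂ) : nome (a + b) = nome a * nome b := by
  unfold nome
  rw [← Complex.exp_add]
  congr 1
  ring

lemma nome_int (n : ℤ) : nome n = 1 := by
  unfold nome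
  rw [Complex.exp_eq_one_iff]
  exact ⟨n, by ring⟩

lemma nome_add_int (a : ℂ) (n : ℤ) : nome (a + n) = nome a := by
  rw [nome_add, nome_int, mul_one]

lemma exists_nome {x : ℂ} (hx : x ≠ 0) (h1 : ‖x‖ < 1) : ∃ τ : ℂ, 0 < τ.im ∧ nome τ = x := by
  refine ⟨Complex.log x / (2 * Real.pi * Complex.I), ?_, ?_⟩
  · have e : Complex.log x / (2 * Real.pi * Complex.I) =
        ((1 / (2 * Real.pi) : ℝ) : ℂ) * (-Complex.I * Complex.log x) := by
      have := Real.pi_ne_zero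
      push_cast
      have hI := Complex.I_sq
      field_simp
      rw [hI]
      ring
    rw [e, Complex.im_ofReal_mul]
    have : (-Complex.I * Complex.log x).im = - Real.log ‖x‖ := by
      simp [Complex.log_re]
    rw [this]
    have := Real.log_neg (norm_pos_iff.mpr hx) h1
    have := Real.pi_pos
    have : 0 < 1 / (2 * Real.pi) := by positivity
    nlinarith
  · unfold nome
    rw [mul_div_cancel₀ _ Complex.two_pi_I_ne_zero, Complex.exp_log hx]

lemma gE_diff : DifferentiableOn ℂ gE (Metric.ball 0 1) :=
  ModularForm.differentiableOn_tprod_one_sub_pow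

lemma gE_mult {x : ℂ} (h : ‖x‖ < 1) : Multipliable fun n : ℕ => 1 - x ^ (n + 1) :=
  ModularForm.multipliable_one_sub_pow h

lemma gE_zero : gE 0 = 1 := by
  simp [gE]

lemma gE_ne {x : ℂ} (h : ‖x‖ < 1) : gE x ≠ 0 := by
  by_cases hx : x = 0
  · rw [hx, gE_zero]; exact one_ne_zero
  obtain ⟨τ, ht, rfl⟩ := exists_nome hx h
  have := ModularForm.eta_ne_zero (z := τ) ht
  rw [← eta_eq, eta_eq_gE] at this
  exact right_ne_zero_of_mul this

lemma pow_lt {x : ℂ} (h : ‖x‖ < 1) {n : ℕ} (hn : n ≠ 0) : ‖x ^ n‖ < 1 := by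
  rw [norm_pow]
  exact pow_lt_one₀ (norm_nonneg _) h hn

/-- The unit part `u` with `G = q u(q)`. -/
noncomputable def gU (x : ℂ) : ℂ := (gE (x ^ 3) / gE x) ^ 12

/-- `G` as a function of `q`. -/
noncomputable def gF (x : ℂ) : ℂ := x * gU x

lemma gU_diff : DifferentiableOn ℂ gU (Metric.ball 0 1) := by
  unfold gU
  refine DifferentiableOn.fun_pow (DifferentiableOn.fun_div ?_ gE_diff ?_) 12
  · refine gE_diff.comp (t := Metric.ball 0 1) (f := fun x : ℂ => x ^ 3) (by fun_prop) ?_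
    intro x hx
    simp only [Metric.mem_ball, dist_zero_right] at hx ⊢
    exact pow_lt hx (by norm_num)
  · intro x hx
    exact gE_ne (by simpa using hx)

lemma gU_zero : gU 0 = 1 := by simp [gU, gE_zero]

lemma gU_ne {x : ℂ} (h : ‖x‖ < 1) : gU x ≠ 0 :=
  pow_ne_zero _ (div_ne_zero (gE_ne (pow_lt h (by norm_num))) (gE_ne h))

lemma gF_diff : DifferentiableOn ℂ gF (Metric.ball 0 1) := by
  unfold gF
  exact DifferentiableOn.fun_mul differentiableOn_id gU_diff

lemma etaG_eq (τ : ℂ) : etaG3A τ = gF (nome τ) := by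
  unfold etaG3A gF gU
  rw [eta_eq_gE, eta_eq_gE, show (3 : ℂ) * τ = ((3 : ℕ) : ℂ) * τ by norm_num, nome_mul,
    mul_pow, mul_pow, div_pow, ← Complex.exp_nat_mul, ← Complex.exp_nat_mul, mul_div_mul_comm,
    ← Complex.exp_sub]
  congr 1
  unfold nome
  congr 1
  push_cast
  ring

lemma G_ne {τ : ℂ} (h : 0 < τ.im) : etaG3A τ ≠ 0 := by
  rw [etaG_eq]
  exact mul_ne_zero (nome_ne _) (gU_ne (norm_nome_lt h))

lemma nome_diff : Differentiable ℂ nome := by unfold nome; fun_prop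

lemma G_diff : DifferentiableOn ℂ etaG3A {τ | 0 < τ.im} := by
  have : etaG3A = fun τ => gF (nome τ) := funext etaG_eq
  rw [this]
  refine gF_diff.comp nome_diff.differentiableOn ?_
  intro x hx
  simpa using norm_nome_lt hx

lemma G_add_int (τ : ℂ) (n : ℤ) : etaG3A (τ + n) = etaG3A τ := by
  rw [etaG_eq, etaG_eq, nome_add_int]

lemma eta12_S {τ : ℂ} (h : 0 < τ.im) : eta (-1 / τ) ^ 12 = - τ ^ 6 * eta τ ^ 12 := by
  have h1 := ModularForm.eta_comp_eq_csqrt_I_inv h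
  simp only [Function.comp, Pi.smul_apply, Pi.mul_apply, smul_eq_mul] at h1
  rw [eta_eq, eta_eq, h1]
  have key : ∀ z : ℂ, z ≠ 0 → Complex.sqrt z ^ 12 = z ^ 6 := by
    intro z hz
    rw [sqrt_eq_exp hz, ← Complex.exp_nat_mul]
    rw [show ((12 : ℕ) : ℂ) * (Complex.log z / 2) = (6 : ℕ) * Complex.log z by push_cast; ring,
      Complex.exp_nat_mul, Complex.exp_log hz]
  have hτ : τ ≠ 0 := by rintro rfl; simp at h
  rw [mul_pow, mul_pow, inv_pow, key _ Complex.I_ne_zero, key _ hτ]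
  have : (Complex.I) ^ 6 = -1 := by
    rw [show (6 : ℕ) = 2 * 3 by norm_num, pow_mul, Complex.I_sq]; norm_num
  rw [this]
  norm_num

lemma eta_ne {τ : ℂ} (h : 0 < τ.im) : eta τ ≠ 0 := by
  rw [eta_eq]; exact ModularForm.eta_ne_zero h

lemma im_three {τ : ℂ} (h : 0 < τ.im) : 0 < (3 * τ).im := by
  simp; exact h

lemma W_im (τ : ℂ) : (-1 / (3 * τ)).im = τ.im / (3 * Complex.normSq τ) := by
  rw [neg_div, Complex.neg_im, one_div, Complex.inv_im]
  simp
  by_cases h : Complex.normSq τ = 0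
  · simp [h]
  · field_simp

lemma normSq_pos' {τ : ℂ} (h : 0 < τ.im) : 0 < Complex.normSq τ := by
  rw [Complex.normSq_pos]; rintro rfl; simp at h

lemma W_pos {τ : ℂ} (h : 0 < τ.im) : 0 < (-1 / (3 * τ)).im := by
  rw [W_im]
  have := normSq_pos' h
  positivity

lemma fricke {τ : ℂ} (h : 0 < τ.im) : etaG3A (-1 / (3 * τ)) = 1 / (729 * etaG3A τ) := by
  have hτ : τ ≠ 0 := by rintro rfl; simp at h
  unfold etaG3A
  rw [show 3 * (-1 / (3 * τ)) = -1 / τ by field_simp, eta12_S h, eta12_S (im_three h)]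
  have := eta_ne h
  have := eta_ne (im_three h)
  field_simp
  norm_num

end C3A

namespace C3A
open Filter Topology

lemma ne_of_im {τ : ℂ} (h : 0 < τ.im) : τ ≠ 0 := by rintro rfl; simp at h

lemma add_int_im (τ : ℂ) (n : ℤ) : (τ + n).im = τ.im := by simp

lemma VW {τ : ℂ} (h : 0 < τ.im) (m : ℤ) :
    τ / (3 * m * τ + 1) = -1 / (3 * (-1 / (3 * τ) + ((-m : ℤ) : ℂ))) := by
  have := ne_of_im h
  have h2 : -1 / (3 * τ) + ((-m : ℤ) : ℂ) ≠ 0 :=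
    ne_of_im (by rw [add_int_im]; exact W_pos h)
  have h3 : 3 * (-1 / (3 * τ) + ((-m : ℤ) : ℂ)) = - (3 * m * τ + 1) / τ := by
    push_cast
    field_simp
    ring
  rw [h3, div_div_eq_mul_div, neg_one_mul, neg_div_neg_eq]

lemma V_pos {τ : ℂ} (h : 0 < τ.im) (m : ℤ) : 0 < (τ / (3 * m * τ + 1)).im := by
  rw [VW h]
  apply W_pos
  rw [add_int_im]
  exact W_pos h

lemma G_V {τ : ℂ} (h : 0 < τ.im) (m : ℤ) : etaG3A (τ / (3 * m * τ + 1)) = etaG3A τ := by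
  rw [VW h, fricke (by rw [add_int_im]; exact W_pos h), G_add_int, fricke h]
  have := G_ne h
  field_simp

lemma round_ex (x y : ℤ) (hy : y ≠ 0) : ∃ k : ℤ, 2 * |x + k * y| ≤ |y| := by
  have h1 := Int.emod_nonneg x hy
  have h2 := Int.emod_lt_abs x hy
  have h3 := Int.emod_add_mul_ediv x y
  by_cases h : 2 * (x % y) ≤ |y|
  · refine ⟨-(x / y), ?_⟩
    have : x + -(x / y) * y = x % y := by linarith [mul_comm y (x / y)]
    rw [this, abs_of_nonneg h1]
    exact h
  · refine ⟨-(x / y) - y.sign, ?_⟩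
    have hs : y.sign * y = |y| := by rw [mul_comm]; exact Int.mul_sign_self y ▸ (by simp)
    have : x + (-(x / y) - y.sign) * y = x % y - |y| := by
      rw [← hs]; linarith [mul_comm y (x / y)]
    rw [this, abs_of_neg (by linarith)]
    linarith

lemma denom_ne {τ : ℂ} (h : 0 < τ.im) {c d : ℤ} (hcd : c ≠ 0 ∨ d ≠ 0) :
    (c : ℂ) * τ + d ≠ 0 := by
  intro h0
  have h1 := congrArg Complex.im h0
  simp at h1
  rcases h1 with h1 | h1
  · subst h1
    simp at h0
    simp [h0] at hcd
  · exact h.ne' h1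

lemma G_gamma (n : ℕ) : ∀ (a b c d : ℤ), c.natAbs = n → a * d - 3 * b * c = 1 →
    ∀ τ : ℂ, 0 < τ.im → etaG3A ((a * τ + b) / (3 * c * τ + d)) = etaG3A τ := by
  induction n using Nat.strong_induction_on with
  | _ n ih =>
  intro a b c d hc hdet τ hτ
  by_cases hc0 : c = 0
  · subst hc0
    have : a * d = 1 := by linarith
    rcases Int.mul_eq_one_iff_eq_one_or_neg_one.mp this with ⟨rfl, rfl⟩ | ⟨rfl, rfl⟩
    · have := G_add_int τ b
      simpa using this
    · have := G_add_int τ (-b)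
      rw [← this]
      congr 1
      push_cast
      ring
  obtain ⟨k, hk⟩ := round_ex d (3 * c) (by omega)
  set d' := d + k * (3 * c) with hd'
  set b' := b + a * k with hb'
  have hdet' : a * d' - 3 * b' * c = 1 := by rw [hd', hb']; linarith
  have hd0 : d' ≠ 0 := by
    intro h0
    rw [h0] at hdet'
    have : 3 * (-(b' * c)) = 1 := by linarith
    omega
  obtain ⟨m, hm⟩ := round_ex c d' hd0
  set c' := c + m * d' with hc'
  set a' := a + 3 * m * b' with ha'
  have hdet'' : a' * d' - 3 * b' * c' = 1 := by rw [hc', ha']; linarith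
  have hlt : c'.natAbs < n := by
    rw [← hc]
    have hpos : 0 < |c| := abs_pos.mpr hc0
    have h3 : |3 * c| = 3 * |c| := by rw [abs_mul]; norm_num
    rw [h3] at hk
    have : |c'| < |c| := by linarith
    zify
    exact this
  set τ1 := τ + ((-k : ℤ) : ℂ) with hτ1
  have hτ1p : 0 < τ1.im := by rw [hτ1, add_int_im]; exact hτ
  set τ2 := τ1 / (3 * ((-m : ℤ) : ℂ) * τ1 + 1) with hτ2
  have hτ2p : 0 < τ2.im := V_pos hτ1p _
  have key := ih _ hlt a' b' c' d' rfl hdet'' τ2 hτ2p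
  rw [hτ2, G_V hτ1p, ← hτ2, hτ1, G_add_int] at key
  rw [← key]
  congr 1
  have e1 : τ2 = τ1 / (1 - 3 * m * τ1) := by rw [hτ2]; push_cast; congr 1; ring
  have n1 : 1 - 3 * (m : ℂ) * τ1 ≠ 0 := by
    have := denom_ne hτ1p (c := -3 * m) (d := 1) (by simp)
    push_cast at this
    intro h0; apply this; linear_combination h0
  have e2 : (a' : ℂ) * τ2 + b' = (a * τ1 + b') / (1 - 3 * m * τ1) := by
    rw [e1, ha']; push_cast; field_simp; ring
  have e3 : 3 * (c' : ℂ) * τ2 + d' = (3 * c * τ1 + d') / (1 - 3 * m * τ1) := by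
    rw [e1, hc']; push_cast; field_simp; ring
  rw [e2, e3, div_div_div_cancel_right₀ n1, hτ1, hb', hd']
  push_cast
  congr 1 <;> ring

lemma G_Gamma0 {a b c d : ℤ} (hdet : a * d - 3 * b * c = 1) {τ : ℂ} (hτ : 0 < τ.im) :
    etaG3A ((a * τ + b) / (3 * c * τ + d)) = etaG3A τ :=
  G_gamma _ a b c d rfl hdet τ hτ

/-- Index set for the Hecke sum: triples `(j, d, b)`. -/
def hS (N : ℕ) : Finset (Σ _ : ℕ × ℕ, ℕ) :=
  ((Nat.divisorsAntidiagonal N).filter (fun x => ¬ 3 ∣ x.1)).sigma (fun x => Finset.range x.2)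

/-- `N T_N G`. -/
noncomputable def hG (N : ℕ) (τ : ℂ) : ℂ :=
  ∑ z ∈ hS N, etaG3A ((z.1.1 * τ + z.2) / z.1.2)

lemma mem_hS {N : ℕ} {z : Σ _ : ℕ × ℕ, ℕ} :
    z ∈ hS N ↔ z.1.1 * z.1.2 = N ∧ N ≠ 0 ∧ ¬ 3 ∣ z.1.1 ∧ z.2 < z.1.2 := by
  unfold hS
  simp [Finset.mem_sigma, Nat.mem_divisorsAntidiagonal, and_assoc]

lemma rep_ex {N : ℕ} (z : Σ _ : ℕ × ℕ, ℕ) (hz : z ∈ hS N) : ∃ w : Σ _ : ℕ × ℕ, ℕ, w ∈ hS N ∧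
    ∃ a b c d : ℤ, a * d - 3 * b * c = 1 ∧ (z.1.1 : ℤ) + 3 * z.2 = a * w.1.1 ∧
      (z.2 : ℤ) = a * w.2 + b * w.1.2 ∧ (z.1.2 : ℤ) = c * w.1.1 ∧
      (z.1.2 : ℤ) = 3 * c * w.2 + d * w.1.2 := by
  obtain ⟨⟨j, d⟩, b⟩ := z
  rw [mem_hS] at hz
  obtain ⟨hN, hN0, h3, hb⟩ := hz
  simp only at hN h3 hb ⊢
  have hd0 : 0 < d := by omega
  have hj0 : 0 < j := by
    rcases Nat.eq_zero_or_pos j with h | h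
    · subst h; simp at h3
    · exact h
  set J := Nat.gcd (j + 3 * b) d with hJ
  have hJ0 : 0 < J := Nat.gcd_pos_of_pos_right _ hd0
  obtain ⟨a1, ha1⟩ : J ∣ j + 3 * b := Nat.gcd_dvd_left _ _
  obtain ⟨c1, hc1⟩ : J ∣ d := Nat.gcd_dvd_right _ _
  have hcop : Nat.Coprime a1 c1 := by
    have := Nat.coprime_div_gcd_div_gcd (m := j + 3 * b) (n := d) hJ0
    rw [← hJ] at this
    rw [ha1, hc1, Nat.mul_div_cancel_left _ hJ0, Nat.mul_div_cancel_left _ hJ0] at this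
    exact this
  have h3J : ¬ 3 ∣ J := by
    intro h
    have : 3 ∣ j + 3 * b := h.trans (Nat.gcd_dvd_left _ _)
    omega
  have h3a : ¬ 3 ∣ a1 := by
    intro h
    have : 3 ∣ j + 3 * b := ha1 ▸ Dvd.dvd.mul_left h J
    omega
  have hcop3 : Nat.Coprime a1 (3 * c1) :=
    Nat.Coprime.mul_right ((Nat.Prime.coprime_iff_not_dvd Nat.prime_three).mpr h3a).symm hcop
  have hbez : IsCoprime (a1 : ℤ) ((3 * c1 : ℕ) : ℤ) := Nat.isCoprime_iff_coprime.mpr hcop3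
  obtain ⟨x, y, hxy⟩ := hbez
  push_cast at hxy
  have ha1' : (j : ℤ) + 3 * b = J * a1 := by exact_mod_cast ha1
  have hc1' : (d : ℤ) = J * c1 := by exact_mod_cast hc1
  set B0 : ℤ := x * b + y * d with hB0
  set D0 : ℤ := -3 * c1 * b + a1 * d with hD0
  have hJD : (J : ℤ) * D0 = N := by
    rw [← hN, hD0]
    push_cast
    linear_combination (-3 * (b : ℤ)) * (-hc1') - d * ha1'
  have hD0p : 0 < D0 := by
    have : (0 : ℤ) < J * D0 := by rw [hJD]; exact_mod_cast Nat.pos_of_ne_zero hN0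
    exact pos_of_mul_pos_right this (by positivity)
  obtain ⟨D, hD⟩ := Int.eq_ofNat_of_zero_le hD0p.le
  have hBn := Int.emod_nonneg B0 hD0p.ne'
  have hBl := Int.emod_lt_of_pos B0 hD0p
  have hBe := Int.emod_add_mul_ediv B0 D0
  obtain ⟨B, hB⟩ := Int.eq_ofNat_of_zero_le hBn
  set k := B0 / D0
  refine ⟨⟨(J, D), B⟩, ?_, a1, -y + a1 * k, c1, x + 3 * c1 * k, ?_, ?_, ?_, ?_, ?_⟩
  · rw [mem_hS]
    refine ⟨?_, hN0, h3J, ?_⟩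
    · simp only
      rw [hD] at hJD
      exact_mod_cast hJD
    · simp only
      zify
      rw [← hB, ← hD]; exact hBl
  · linear_combination hxy
  · simp only; linear_combination ha1'
  · simp only
    rw [← hD, ← hB]
    have : B0 % D0 = B0 - D0 * k := by linarith
    rw [this, hB0, hD0]
    linear_combination (-(b : ℤ)) * hxy
  · simp only; linear_combination hc1'
  · simp only
    rw [← hD, ← hB]
    have : B0 % D0 = B0 - D0 * k := by linarith
    rw [this, hB0, hD0]
    linear_combination (-(d : ℤ)) * hxy

lemma rep_inj {N : ℕ} (z z' w : Σ _ : ℕ × ℕ, ℕ) (hz : z ∈ hS N) (hz' : z' ∈ hS N) (hw : w ∈ hS N)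
    (h : ∃ a b c d : ℤ, a * d - 3 * b * c = 1 ∧ (z.1.1 : ℤ) + 3 * z.2 = a * w.1.1 ∧
      (z.2 : ℤ) = a * w.2 + b * w.1.2 ∧ (z.1.2 : ℤ) = c * w.1.1 ∧
      (z.1.2 : ℤ) = 3 * c * w.2 + d * w.1.2)
    (h' : ∃ a b c d : ℤ, a * d - 3 * b * c = 1 ∧ (z'.1.1 : ℤ) + 3 * z'.2 = a * w.1.1 ∧
      (z'.2 : ℤ) = a * w.2 + b * w.1.2 ∧ (z'.1.2 : ℤ) = c * w.1.1 ∧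
      (z'.1.2 : ℤ) = 3 * c * w.2 + d * w.1.2) : z = z' := by
  obtain ⟨⟨j, d⟩, b⟩ := z
  obtain ⟨⟨j', d'⟩, b'⟩ := z'
  obtain ⟨⟨J, D⟩, B⟩ := w
  rw [mem_hS] at hz hz' hw
  obtain ⟨hN, hN0, h3, hb⟩ := hz
  obtain ⟨hN', -, h3', hb'⟩ := hz'
  obtain ⟨hNw, -, h3w, hbw⟩ := hw
  simp only at *
  obtain ⟨a1, b1, c1, d1, hdet1, e1, e2, e3, e4⟩ := h
  obtain ⟨a2, b2, c2, d2, hdet2, f1, f2, f3, f4⟩ := h'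
  have hDp : (0 : ℤ) < D := by omega
  have hJp : (0 : ℤ) < J := by
    rcases Nat.eq_zero_or_pos J with h | h
    · subst h; simp at h3w
    · exact_mod_cast h
  have hdp : (0 : ℤ) < d := by omega
  have hdp' : (0 : ℤ) < d' := by omega
  have hc1 : 0 < c1 := by rw [e3] at hdp; exact pos_of_mul_pos_left hdp hJp.le
  have hc2 : 0 < c2 := by rw [f3] at hdp'; exact pos_of_mul_pos_left hdp' hJp.le
  have g1 : c1 * (J - 3 * B) = d1 * D := by linarith
  have g2 : c2 * (J - 3 * B) = d2 * D := by linarith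
  have g3 : c1 * d2 = c2 * d1 := by
    have : (c1 * d2) * D = (c2 * d1) * D := by linear_combination c2 * g1 - c1 * g2
    exact mul_right_cancel₀ hDp.ne' this
  have hd12 : c1 ∣ c2 := by
    refine ⟨a1 * d2 - 3 * b1 * c2, ?_⟩
    linear_combination (-c2) * hdet1 - a1 * g3
  have hd21 : c2 ∣ c1 := by
    refine ⟨a2 * d1 - 3 * b2 * c1, ?_⟩
    linear_combination (-c1) * hdet2 + a2 * g3
  have hcc : c1 = c2 := Int.dvd_antisymm hc1.le hc2.le hd12 hd21
  subst hcc
  have hdd : d1 = d2 := by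
    have : c1 * d1 = c1 * d2 := by linarith
    exact mul_left_cancel₀ hc1.ne' this
  subst hdd
  have hD : d = d' := by
    have : (d : ℤ) = d' := by rw [e3, f3]
    exact_mod_cast this
  subst hD
  have hj : j = j' := by
    have h0 : j * d = j' * d := by rw [hN, hN']
    exact Nat.eq_of_mul_eq_mul_right (by exact_mod_cast hdp) h0
  subst hj
  have hbb : (b : ℤ) - b' = (a1 * b2 - a2 * b1) * (- d) := by
    rw [e2, f2, e4]
    have h5 : (a1 - a2) * d1 = 3 * (b1 - b2) * c1 := by linarith
    linear_combination (-(a1 : ℤ) * B - b1 * D) * hdet2 + (a2 * B + b2 * D) * hdet1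
  have : b = b' := by
    have hdvd : (d : ℤ) ∣ b - b' := ⟨-(a1 * b2 - a2 * b1), by rw [hbb]; ring⟩
    have hbd : |(b : ℤ) - b'| < d := by
      rw [abs_lt]; constructor <;> omega
    have := Int.eq_zero_of_abs_lt_dvd hdvd hbd
    omega
  subst this
  rfl

lemma hS_im {N : ℕ} {z : Σ _ : ℕ × ℕ, ℕ} (hz : z ∈ hS N) {τ : ℂ} :
    (((z.1.1 : ℂ) * τ + z.2) / z.1.2).im = z.1.1 / z.1.2 * τ.im := by
  rw [Complex.div_natCast_im]
  simp
  ring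

lemma hS_pos {N : ℕ} {z : Σ _ : ℕ × ℕ, ℕ} (hz : z ∈ hS N) : 0 < z.1.1 ∧ 0 < z.1.2 := by
  rw [mem_hS] at hz
  constructor
  · rcases Nat.eq_zero_or_pos z.1.1 with h | h
    · rw [h] at hz; simp at hz
    · exact h
  · omega

lemma hS_im_pos {N : ℕ} {z : Σ _ : ℕ × ℕ, ℕ} (hz : z ∈ hS N) {τ : ℂ} (h : 0 < τ.im) :
    0 < (((z.1.1 : ℂ) * τ + z.2) / z.1.2).im := by
  rw [hS_im hz]
  obtain ⟨h1, h2⟩ := hS_pos hz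
  positivity

lemma hG_V (N : ℕ) {τ : ℂ} (h : 0 < τ.im) : hG N (τ / (3 * τ + 1)) = hG N τ := by
  choose! f hf hr using rep_ex (N := N)
  unfold hG
  refine Finset.sum_nbij f hf ?_ ?_ ?_
  · intro z hz z' hz' hzz
    refine rep_inj z z' (f z) hz hz' (hf z hz) (hr z hz) ?_
    rw [hzz]
    exact hr z' hz'
  · refine Finset.surjOn_of_injOn_of_card_le f hf ?_ le_rfl
    intro z hz z' hz' hzz
    refine rep_inj z z' (f z) hz hz' (hf z hz) (hr z hz) ?_
    rw [hzz]
    exact hr z' hz'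
  · intro z hz
    obtain ⟨a, b, c, d, hdet, e1, e2, e3, e4⟩ := hr z hz
    have hwp := hS_im_pos (hf z hz) h
    rw [← G_Gamma0 hdet hwp]
    congr 1
    obtain ⟨p1, p2⟩ := hS_pos (hf z hz)
    obtain ⟨q1, q2⟩ := hS_pos hz
    have n2 : (((f z).1.2 : ℕ) : ℂ) ≠ 0 := by exact_mod_cast p2.ne'
    have n3 : ((z.1.2 : ℕ) : ℂ) ≠ 0 := by exact_mod_cast q2.ne'
    have n4 : 3 * τ + 1 ≠ 0 := by
      have := denom_ne h (c := 3) (d := 1) (by simp)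
      simpa using this
    have E1 : (z.1.1 : ℂ) + 3 * z.2 = a * (f z).1.1 := by exact_mod_cast e1
    have E2 : (z.2 : ℂ) = a * (f z).2 + b * (f z).1.2 := by exact_mod_cast e2
    have E3 : (z.1.2 : ℂ) = c * (f z).1.1 := by exact_mod_cast e3
    have E4 : (z.1.2 : ℂ) = 3 * c * (f z).2 + d * (f z).1.2 := by exact_mod_cast e4
    have s1 : ((z.1.1 : ℂ) * (τ / (3 * τ + 1)) + z.2) / z.1.2 =
        (((z.1.1 : ℂ) + 3 * z.2) * τ + z.2) / (3 * z.1.2 * τ + z.1.2) := by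
      rw [show 3 * (z.1.2 : ℂ) * τ + z.1.2 = (3 * τ + 1) * z.1.2 by ring, ← div_div]
      congr 1
      rw [eq_div_iff n4, add_mul, mul_assoc, div_mul_cancel₀ _ n4]
      ring
    have s2 : (a : ℂ) * (((f z).1.1 * τ + (f z).2) / (f z).1.2) + b =
        (((z.1.1 : ℂ) + 3 * z.2) * τ + z.2) / (f z).1.2 := by
      rw [E1, E2]; field_simp; ring
    have s3 : 3 * (c : ℂ) * (((f z).1.1 * τ + (f z).2) / (f z).1.2) + d =
        (3 * z.1.2 * τ + z.1.2) / (f z).1.2 := by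
      rw [E3]
      rw [E3] at E4
      nth_rewrite 2 [E4]
      field_simp; ring
    rw [s1, s2, s3, div_div_div_cancel_right₀ n2]

end C3A

namespace C3A
open Filter Topology

/-- The filter at `i∞`. -/
abbrev iInf : Filter ℂ := Filter.comap Complex.im Filter.atTop

lemma ev_im (B : ℝ) : ∀ᶠ t in iInf, B < t.im :=
  (tendsto_comap (f := Complex.im) (x := atTop)).eventually (eventually_gt_atTop B)

lemma nome_tendsto : Tendsto nome iInf (𝓝 0) := by
  rw [tendsto_zero_iff_norm_tendsto_zero]
  simp_rw [norm_nome]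
  refine Real.tendsto_exp_neg_atTop_nhds_zero.comp ?_
  exact (tendsto_comap (f := Complex.im) (x := atTop)).const_mul_atTop (by positivity)

lemma gU_cont : ContinuousAt gU 0 :=
  (gU_diff.differentiableAt (Metric.ball_mem_nhds _ one_pos)).continuousAt

lemma gU_tendsto : Tendsto (fun t => gU (nome t)) iInf (𝓝 1) := by
  have := gU_cont.tendsto
  rw [gU_zero] at this
  exact this.comp nome_tendsto

lemma G_tendsto : Tendsto etaG3A iInf (𝓝 0) := by
  have : etaG3A = fun t => nome t * gU (nome t) := funext etaG_eq
  rw [this]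
  simpa using nome_tendsto.mul gU_tendsto

lemma exp_div_G_bdd : (fun t : ℂ => (Real.exp (-2 * π * t.im / 1))) =O[iInf] etaG3A := by
  have h1 : (fun t : ℂ => nome t) =O[iInf] etaG3A := by
    have h2 : (fun t => (gU (nome t))⁻¹) =O[iInf] (fun _ => (1 : ℂ)) :=
      (gU_tendsto.inv₀ one_ne_zero).isBigO_one ℂ
    have h3 := (Asymptotics.isBigO_refl etaG3A iInf).mul h2
    refine (h3.congr' ?_ ?_)
    · filter_upwards [ev_im 0] with t ht
      rw [etaG_eq, gF]
      field_simp [gU_ne (norm_nome_lt ht)]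
    · simp
  refine (h1.norm_left).congr_left ?_
  intro t
  rw [norm_nome]
  congr 1
  ring

lemma WW {τ : ℂ} (h : 0 < τ.im) : -1 / (3 * (-1 / (3 * τ))) = τ := by
  have := ne_of_im h
  field_simp

lemma W_diff : DifferentiableOn ℂ (fun τ : ℂ => -1 / (3 * τ)) {τ | 0 < τ.im} := by
  refine DifferentiableOn.fun_div (by fun_prop) (by fun_prop) ?_
  intro x hx
  have := ne_of_im hx
  simpa using this

lemma isOpenH : IsOpen {τ : ℂ | 0 < τ.im} := isOpen_lt continuous_const Complex.continuous_im

lemma isPreH : IsPreconnected {τ : ℂ | 0 < τ.im} := (convex_halfSpace_im_gt 0).isPreconnected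

lemma per_int {f : ℂ → ℂ} (hT : ∀ τ : ℂ, 0 < τ.im → f (τ + 1) = f τ) (n : ℤ) :
    ∀ τ : ℂ, 0 < τ.im → f (τ + n) = f τ := by
  induction n using Int.induction_on with
  | zero => intro τ _; simp
  | succ i ih =>
    intro τ h
    rw [← ih τ h, ← hT (τ + (i : ℤ)) (by simpa using h)]
    congr 1
    push_cast; ring
  | pred i ih =>
    intro τ h
    rw [← ih τ h, ← hT (τ + ((-(i : ℤ) - 1 : ℤ) : ℂ)) (by rw [add_int_im]; exact h)]
    congr 1
    push_cast; ring

lemma reduce {h : ℂ → ℂ} (hT : ∀ τ : ℂ, 0 < τ.im → h (τ + 1) = h τ)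
    (hW : ∀ τ : ℂ, 0 < τ.im → h (-1 / (3 * τ)) = h τ) (n : ℕ) :
    ∀ τ : ℂ, 0 < τ.im → (1 / 10 : ℝ) * (4 / 5) ^ n ≤ τ.im →
      ∃ τ' : ℂ, |τ'.re| ≤ 1 / 2 ∧ 1 / 10 ≤ τ'.im ∧ h τ' = h τ := by
  induction n with
  | zero =>
    intro τ hp hn
    refine ⟨τ + ((-round τ.re : ℤ) : ℂ), ?_, ?_, per_int hT _ τ hp⟩
    · have := abs_sub_round τ.re
      simpa [sub_eq_add_neg] using this
    · rw [add_int_im]; linarith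
  | succ n ih =>
    intro τ hp hn
    set t := τ + ((-round τ.re : ℤ) : ℂ) with ht
    have hre : |t.re| ≤ 1 / 2 := by
      have := abs_sub_round τ.re
      simpa [ht, sub_eq_add_neg] using this
    have him : t.im = τ.im := add_int_im _ _
    have hht : h t = h τ := per_int hT _ τ hp
    by_cases hc : 1 / 10 ≤ t.im
    · exact ⟨t, hre, hc, hht⟩
    push Not at hc
    have htp : 0 < t.im := by rw [him]; exact hp
    have hns : Complex.normSq t ≤ 0.26 := by
      rw [Complex.normSq_apply]
      have := abs_le.mp hre
      nlinarith
    have hnp := normSq_pos' htp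
    have hwim : (1 / 10 : ℝ) * (4 / 5) ^ n ≤ (-1 / (3 * t)).im := by
      rw [W_im, le_div_iff₀ (by positivity)]
      rw [← him, pow_succ] at hn
      have hx : 0 < (1 / 10 : ℝ) * (4 / 5) ^ n := by positivity
      nlinarith
    obtain ⟨τ', a, b, c⟩ := ih _ (W_pos htp) hwim
    exact ⟨τ', a, b, by rw [c, hW t htp, hht]⟩

lemma reduce' {h : ℂ → ℂ} (hT : ∀ τ : ℂ, 0 < τ.im → h (τ + 1) = h τ)
    (hW : ∀ τ : ℂ, 0 < τ.im → h (-1 / (3 * τ)) = h τ) (τ : ℂ) (hp : 0 < τ.im) :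
      ∃ τ' : ℂ, |τ'.re| ≤ 1 / 2 ∧ 1 / 10 ≤ τ'.im ∧ h τ' = h τ := by
  obtain ⟨n, hn⟩ := exists_pow_lt_of_lt_one (show 0 < 10 * τ.im by positivity)
    (show (4 / 5 : ℝ) < 1 by norm_num)
  exact reduce hT hW n τ hp (by linarith)

lemma lemA {f : ℂ → ℂ} (hd : DifferentiableOn ℂ f {τ | 0 < τ.im})
    (hT : ∀ τ : ℂ, 0 < τ.im → f (τ + 1) = f τ)
    (hW : ∀ τ : ℂ, 0 < τ.im → f (-1 / (3 * (τ + 1))) = f (-1 / (3 * τ)))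
    (h0 : Tendsto f iInf (𝓝 0))
    (hb : (fun t => f (-1 / (3 * t))) =O[iInf] (fun _ => (1 : ℂ))) :
    ∀ τ : ℂ, 0 < τ.im → f τ = 0 := by
  have hdW : DifferentiableOn ℂ (fun t => f (-1 / (3 * t))) {τ | 0 < τ.im} :=
    hd.comp W_diff (fun t ht => W_pos ht)
  set h : ℂ → ℂ := fun τ => f τ * f (-1 / (3 * τ)) with hh
  have hhd : DifferentiableOn ℂ h {τ | 0 < τ.im} := hd.fun_mul hdW
  have hhT : ∀ τ : ℂ, 0 < τ.im → h (τ + 1) = h τ := by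
    intro τ hp
    simp only [hh]
    rw [hT τ hp, hW τ hp]
  have hhW : ∀ τ : ℂ, 0 < τ.im → h (-1 / (3 * τ)) = h τ := by
    intro τ hp
    simp only [hh]
    rw [WW hp, mul_comm]
  have hh0 : Tendsto h iInf (𝓝 0) := by
    have h1 : f =o[iInf] (fun _ => (1 : ℂ)) := (Asymptotics.isLittleO_one_iff ℂ).mpr h0
    have h2 := h1.mul_isBigO hb
    simp only [mul_one] at h2
    exact (Asymptotics.isLittleO_one_iff ℂ).mp h2
  have hzero : ∀ τ ∈ {τ : ℂ | 0 < τ.im}, h τ = 0 := by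
    by_contra hcon
    push Not at hcon
    obtain ⟨τ0, hp0, hne0⟩ := hcon
    have hpos : 0 < ‖h τ0‖ := norm_pos_iff.mpr hne0
    have hev : ∀ᶠ t in iInf, ‖h t‖ < ‖h τ0‖ := by
      have := hh0.norm
      rw [norm_zero] at this
      exact this.eventually (gt_mem_nhds hpos)
    rw [eventually_comap] at hev
    obtain ⟨B, hB⟩ := eventually_atTop.mp hev
    obtain ⟨τ1, hr1, hi1, he1⟩ := reduce' hhT hhW τ0 hp0
    set K : Set ℂ := Set.Icc (-(1 / 2) : ℝ) (1 / 2) ×ℂ Set.Icc (1 / 10 : ℝ) B with hK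
    have hKc : IsCompact K := isCompact_Icc.reProdIm isCompact_Icc
    have hKH : K ⊆ {τ : ℂ | 0 < τ.im} := by
      intro t ht
      have := ht.2.1
      simp only [Set.mem_setOf_eq]
      linarith
    have hin : ∀ t : ℂ, |t.re| ≤ 1 / 2 → 1 / 10 ≤ t.im → t ∈ K ∨ ‖h t‖ < ‖h τ0‖ := by
      intro t h1 h2
      by_cases h3 : t.im ≤ B
      · left
        exact ⟨abs_le.mp h1, h2, h3⟩
      · right
        exact hB t.im (by linarith) t rfl
    have hτ1 : τ1 ∈ K := by
      rcases hin τ1 hr1 hi1 with h | h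
      · exact h
      · rw [he1] at h; exact absurd h (lt_irrefl _)
    obtain ⟨m, hmK, hm⟩ := hKc.exists_isMaxOn ⟨τ1, hτ1⟩
      (hhd.continuousOn.mono hKH).norm
    have h01 : ‖h τ0‖ ≤ ‖h m‖ := by rw [← he1]; exact hm hτ1
    have hmax : IsMaxOn (norm ∘ h) {τ : ℂ | 0 < τ.im} m := by
      intro τ hτ
      obtain ⟨t, a, b, c⟩ := reduce' hhT hhW τ hτ
      simp only [Set.mem_setOf_eq, Function.comp]
      rw [← c]
      rcases hin t a b with h' | h'
      · exact hm h'
      · exact h'.le.trans h01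
    have hconst := Complex.eqOn_of_isPreconnected_of_isMaxOn_norm isPreH isOpenH hhd (hKH hmK) hmax
    have hBm : 0 < max B 1 := by positivity
    have h3 := hB (max B 1) (le_max_left _ _) ((max B 1 : ℝ) * Complex.I) (by simp)
    have h4 := hconst (show ((max B 1 : ℝ) * Complex.I : ℂ) ∈ {τ : ℂ | 0 < τ.im} by simp)
    rw [h4] at h3
    simp only [Function.const_apply] at h3
    linarith
  have hana : AnalyticOnNhd ℂ f {τ | 0 < τ.im} := hd.analyticOnNhd isOpenH
  have hanaW : AnalyticOnNhd ℂ (fun t => f (-1 / (3 * t))) {τ | 0 < τ.im} :=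
    hdW.analyticOnNhd isOpenH
  rcases AnalyticOnNhd.eq_zero_or_eq_zero_of_mul_eq_zero hana hanaW hzero isPreH with h | h
  · exact h
  · intro τ hτ
    have := h _ (W_pos hτ)
    simpa only [WW hτ] using this

lemma lemB (N : ℕ) : ∀ {f : ℂ → ℂ} (_ : DifferentiableOn ℂ f {τ | 0 < τ.im})
    (_ : ∀ τ : ℂ, 0 < τ.im → f (τ + 1) = f τ)
    (_ : ∀ τ : ℂ, 0 < τ.im → f (-1 / (3 * (τ + 1))) = f (-1 / (3 * τ)))
    (_ : Tendsto f iInf (𝓝 0))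
    (_ : (fun t => f (-1 / (3 * t)) * etaG3A t ^ N) =O[iInf] (fun _ => (1 : ℂ))),
    ∃ c : ℕ → ℂ, ∀ τ : ℂ, 0 < τ.im → f τ = ∑ k ∈ Finset.Icc 1 N, c k * etaG3A τ ^ k := by
  induction N with
  | zero =>
    intro f hd hT hW h0 hb
    refine ⟨0, fun τ hτ => ?_⟩
    simp only [pow_zero, mul_one] at hb
    simp [lemA hd hT hW h0 hb τ hτ]
  | succ N ih =>
    intro f hd hT hW h0 hb
    have hdW : DifferentiableOn ℂ (fun t => f (-1 / (3 * t))) {τ | 0 < τ.im} :=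
      hd.comp W_diff (fun t ht => W_pos ht)
    classical
    set F : ℂ → ℂ := fun t => if 0 < t.im then f (-1 / (3 * t)) * etaG3A t ^ (N + 1) else 0 with hF
    have hFe : ∀ t : ℂ, 0 < t.im → F t = f (-1 / (3 * t)) * etaG3A t ^ (N + 1) := by
      intro t ht; simp only [hF]; rw [if_pos ht]
    have hFev : F =ᶠ[iInf] fun t => f (-1 / (3 * t)) * etaG3A t ^ (N + 1) := by
      filter_upwards [ev_im 0] with t ht using hFe t ht
    have hper : Function.Periodic F ((1 : ℝ) : ℂ) := by
      intro t
      have e : (t + ((1 : ℝ) : ℂ)).im = t.im := by simp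
      by_cases ht : 0 < t.im
      · rw [hFe _ (by rw [e]; exact ht), hFe t ht]
        have := G_add_int t 1
        push_cast at this ⊢
        rw [hW t ht, this]
      · simp only [hF]
        rw [if_neg ht, if_neg (by rw [e]; exact ht)]
    have hol : ∀ᶠ t in iInf, DifferentiableAt ℂ F t := by
      filter_upwards [ev_im 0] with t ht
      have h1 : DifferentiableAt ℂ (fun t => f (-1 / (3 * t)) * etaG3A t ^ (N + 1)) t :=
        (hdW.fun_mul (G_diff.fun_pow _)).differentiableAt (isOpenH.mem_nhds ht)
      refine h1.congr_of_eventuallyEq ?_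
      filter_upwards [isOpenH.mem_nhds ht] with s hs using hFe s hs
    have hbd : BoundedAtFilter iInf F := by
      unfold BoundedAtFilter
      have h1 : F =O[iInf] (fun _ => (1 : ℂ)) := hb.congr' hFev.symm EventuallyEq.rfl
      exact h1.trans (Asymptotics.isBigO_const_const (1 : ℂ) (one_ne_zero (α := ℝ)) _)
    have hdec := Function.Periodic.exp_decay_sub_of_bounded_at_inf one_pos hper hol hbd
    set c := Function.Periodic.cuspFunction 1 F 0 with hc
    have hdec2 := hdec.trans exp_div_G_bdd
    set f1 : ℂ → ℂ := fun τ => f τ - c * 729 ^ (N + 1) * etaG3A τ ^ (N + 1) with hf1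
    have key : ∃ c : ℕ → ℂ, ∀ τ : ℂ, 0 < τ.im → f1 τ = ∑ k ∈ Finset.Icc 1 N, c k * etaG3A τ ^ k := by
      refine ih (f := f1) ?_ ?_ ?_ ?_ ?_
      · exact hd.fun_sub ((G_diff.fun_pow _).const_mul _)
      · intro τ hτ
        have := G_add_int τ 1
        push_cast at this
        simp only [hf1]
        rw [hT τ hτ, this]
      · intro τ hτ
        have hτ1 : 0 < (τ + 1).im := by simpa using hτ
        have := G_add_int τ 1
        push_cast at this
        simp only [hf1]
        rw [hW τ hτ, fricke hτ, fricke hτ1, this]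
      · have := h0.sub ((G_tendsto.pow (N + 1)).const_mul (c * 729 ^ (N + 1)))
        simpa using this
      · have h3 := hdec2.mul (Asymptotics.isBigO_refl (fun t => (etaG3A t)⁻¹) iInf)
        refine h3.congr' ?_ ?_
        · filter_upwards [ev_im 0] with t ht
          have := G_ne ht
          simp only [hf1]
          rw [hFe t ht, fricke ht]
          generalize f (-1 / (3 * t)) = X
          rw [one_div, inv_pow, mul_pow]
          field_simp
          ring
        · filter_upwards [ev_im 0] with t ht
          have := G_ne ht
          field_simp
    obtain ⟨c', hc'⟩ := key
    refine ⟨fun k => if k = N + 1 then c * 729 ^ (N + 1) else c' k, fun τ hτ => ?_⟩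
    rw [Finset.sum_Icc_succ_top (by omega)]
    have h1 := hc' τ hτ
    simp only [hf1] at h1
    beta_reduce
    rw [if_pos rfl, sub_eq_iff_eq_add.mp h1]
    congr 1
    refine Finset.sum_congr rfl fun k hk => ?_
    beta_reduce
    rw [if_neg (by have := Finset.mem_Icc.mp hk; omega)]

end C3A

namespace C3A
open Filter Topology

lemma hs_congr {ι : Type*} {f g : ι → ℂ} {s : ℂ} (h : HasSum f s) (e : ∀ n, f n = g n) : HasSum g s := by
  rwa [← show f = g from funext e]

/-- partial products -/
noncomputable def pU (x : ℂ) (K : ℕ) : ℂ :=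
  ∏ n ∈ Finset.range K, (1 + x ^ (n + 1) + (x ^ (n + 1)) ^ 2)

lemma one_sub_ne {x : ℂ} (h : ‖x‖ < 1) (n : ℕ) : 1 - x ^ (n + 1) ≠ 0 := by
  intro h0
  have h1 : x ^ (n + 1) = 1 := (sub_eq_zero.mp h0).symm
  have h2 := pow_lt h (n := n + 1) (by omega)
  rw [h1] at h2
  simp at h2

lemma pU_tendsto {x : ℂ} (h : ‖x‖ < 1) : Tendsto (pU x) atTop (𝓝 (gE (x ^ 3) / gE x)) := by
  have h1 := (gE_mult (pow_lt h (n := 3) (by norm_num))).hasProd.tendsto_prod_nat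
  have h2 := (gE_mult h).hasProd.tendsto_prod_nat
  refine (h1.div h2 (gE_ne h)).congr fun K => ?_
  simp only [Pi.div_apply]
  rw [← Finset.prod_div_distrib]
  refine Finset.prod_congr rfl fun n _ => ?_
  have := one_sub_ne h n
  rw [div_eq_iff this]
  ring

lemma fac_le {x : ℂ} {r : ℝ} (h : ‖x‖ ≤ r) (n : ℕ) :
    ‖1 + x ^ (n + 1) + (x ^ (n + 1)) ^ 2‖ ≤ 1 + r ^ (n + 1) + (r ^ (n + 1)) ^ 2 := by
  have h0 : ‖x ^ (n + 1)‖ ≤ r ^ (n + 1) := by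
    rw [norm_pow]; exact pow_le_pow_left₀ (norm_nonneg _) h _
  refine (norm_add_le _ _).trans (add_le_add ((norm_add_le _ _).trans ?_) ?_)
  · simpa using h0
  · rw [norm_pow]; exact pow_le_pow_left₀ (norm_nonneg _) h0 _

lemma norm_fac {r : ℝ} (h : 0 ≤ r) (n : ℕ) :
    ‖1 + (r : ℂ) ^ (n + 1) + ((r : ℂ) ^ (n + 1)) ^ 2‖ = 1 + r ^ (n + 1) + (r ^ (n + 1)) ^ 2 := by
  rw [show 1 + (r : ℂ) ^ (n + 1) + ((r : ℂ) ^ (n + 1)) ^ 2 =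
    ((1 + r ^ (n + 1) + (r ^ (n + 1)) ^ 2 : ℝ) : ℂ) by push_cast; ring, Complex.norm_real,
    Real.norm_of_nonneg (by positivity)]

lemma pU_le {x : ℂ} {r : ℝ} (h : ‖x‖ ≤ r) (K M : ℕ) :
    ‖pU x (K + M)‖ * ‖pU r K‖ ≤ ‖pU x K‖ * ‖pU r (K + M)‖ := by
  have hr : 0 ≤ r := (norm_nonneg _).trans h
  unfold pU
  rw [Finset.prod_range_add, Finset.prod_range_add, norm_mul, norm_mul]
  have : ‖∏ i ∈ Finset.range M, (1 + x ^ (K + i + 1) + (x ^ (K + i + 1)) ^ 2)‖ ≤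
      ‖∏ i ∈ Finset.range M, (1 + (r : ℂ) ^ (K + i + 1) + ((r : ℂ) ^ (K + i + 1)) ^ 2)‖ := by
    rw [norm_prod, norm_prod]
    refine Finset.prod_le_prod (fun _ _ => norm_nonneg _) fun i _ => ?_
    rw [norm_fac hr]
    exact fac_le h _
  calc _ = ‖∏ n ∈ Finset.range K, (1 + x ^ (n + 1) + (x ^ (n + 1)) ^ 2)‖ *
        ‖∏ n ∈ Finset.range K, (1 + (r : ℂ) ^ (n + 1) + ((r : ℂ) ^ (n + 1)) ^ 2)‖ *
        ‖∏ i ∈ Finset.range M, (1 + x ^ (K + i + 1) + (x ^ (K + i + 1)) ^ 2)‖ := by ring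
    _ ≤ ‖∏ n ∈ Finset.range K, (1 + x ^ (n + 1) + (x ^ (n + 1)) ^ 2)‖ *
        ‖∏ n ∈ Finset.range K, (1 + (r : ℂ) ^ (n + 1) + ((r : ℂ) ^ (n + 1)) ^ 2)‖ *
        ‖∏ i ∈ Finset.range M, (1 + (r : ℂ) ^ (K + i + 1) + ((r : ℂ) ^ (K + i + 1)) ^ 2)‖ := by
      gcongr
    _ = _ := by ring

lemma gQ_le {x : ℂ} {r : ℝ} (h : ‖x‖ ≤ r) (hr : r < 1) (K : ℕ) :
    ‖gE (x ^ 3) / gE x‖ * ‖pU r K‖ ≤ ‖pU x K‖ * ‖gE ((r : ℂ) ^ 3) / gE r‖ := by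
  have hr0 : 0 ≤ r := (norm_nonneg _).trans h
  have hrn : ‖(r : ℂ)‖ < 1 := by rwa [Complex.norm_real, Real.norm_of_nonneg hr0]
  have h1 := ((pU_tendsto (h.trans_lt hr)).comp (tendsto_add_atTop_nat K)).norm.mul_const ‖pU r K‖
  have h2 := ((pU_tendsto hrn).comp (tendsto_add_atTop_nat K)).norm.const_mul ‖pU x K‖
  refine le_of_tendsto_of_tendsto' h1 h2 fun M => ?_
  simp only [Function.comp]
  rw [add_comm]
  exact pU_le h K M

lemma gU_norm (x : ℂ) : ‖gU x‖ = ‖gE (x ^ 3) / gE x‖ ^ 12 := by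
  unfold gU; rw [norm_pow]

lemma norm_gU_le {x : ℂ} {r : ℝ} (h : ‖x‖ ≤ r) (hr : r < 1) : ‖gU x‖ ≤ ‖gU r‖ := by
  rw [gU_norm, gU_norm]
  have := gQ_le h hr 0
  simp only [pU, Finset.range_zero, Finset.prod_empty, norm_one, mul_one, one_mul] at this
  gcongr

lemma one_le_gU {r : ℝ} (h : 0 ≤ r) (hr : r < 1) : 1 ≤ ‖gU r‖ := by
  have := norm_gU_le (x := 0) (r := r) (by simpa using h) hr
  simpa [gU_zero] using this

lemma nome_I (y : ℝ) : nome (y * Complex.I) = (Real.exp (-(2 * π * y)) : ℝ) := by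
  unfold nome
  push_cast
  congr 1
  rw [show 2 * (π : ℂ) * Complex.I * (y * Complex.I) = 2 * π * y * (Complex.I * Complex.I) by ring,
    Complex.I_mul_I]
  ring

lemma exp_lt {y : ℝ} (h : 0 < y) : Real.exp (-(2 * π * y)) < 1 := by
  rw [Real.exp_lt_one_iff]
  have := Real.pi_pos
  have : 0 < 2 * Real.pi * y := by positivity
  linarith

lemma norm_G_I {y : ℝ} : ‖etaG3A (y * Complex.I)‖ =
    Real.exp (-(2 * π * y)) * ‖gU (Real.exp (-(2 * π * y)) : ℝ)‖ := by
  rw [etaG_eq, gF, nome_I, norm_mul, Complex.norm_real, Real.norm_of_nonneg (Real.exp_pos _).le]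

lemma norm_G_le {y : ℝ} (h : 0 < y) {z : ℂ} (hz : y ≤ z.im) :
    ‖etaG3A z‖ ≤ ‖etaG3A (y * Complex.I)‖ := by
  have h1 : ‖nome z‖ ≤ Real.exp (-(2 * π * y)) := by
    rw [norm_nome]
    have := Real.pi_pos
    gcongr
  rw [norm_G_I, etaG_eq, gF, norm_mul]
  exact mul_le_mul h1 (norm_gU_le h1 (exp_lt h)) (norm_nonneg _) (Real.exp_pos _).le

lemma G_I_ge {y : ℝ} (h : 0 < y) : Real.exp (-(2 * π * y)) ≤ ‖etaG3A (y * Complex.I)‖ := by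
  rw [norm_G_I]
  exact le_mul_of_one_le_right (Real.exp_pos _).le (one_le_gU (Real.exp_pos _).le (exp_lt h))

lemma W_I {y : ℝ} (h : 0 < y) : -1 / (3 * ((y : ℂ) * Complex.I)) = ((1 / (3 * y) : ℝ) : ℂ) * Complex.I := by
  have h1 : (y : ℂ) ≠ 0 := by exact_mod_cast h.ne'
  have := Complex.I_ne_zero
  push_cast
  field_simp
  rw [Complex.I_sq]

lemma fricke_I {y : ℝ} (h : 0 < y) :
    etaG3A (((1 / (3 * y) : ℝ) : ℂ) * Complex.I) = 1 / (729 * etaG3A (y * Complex.I)) := by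
  rw [← W_I h]
  exact fricke (by simpa using h)

lemma G_I_le {y : ℝ} (h : 0 < y) :
    ‖etaG3A (y * Complex.I)‖ ≤ Real.exp (2 * π * (1 / (3 * y))) := by
  have h3 : 0 < 1 / (3 * y) := by positivity
  have h1 := fricke_I h3
  rw [show 1 / (3 * (1 / (3 * y))) = y by field_simp] at h1
  rw [h1, norm_div, norm_mul]
  have h2 := G_I_ge h3
  rw [Real.exp_neg] at h2
  have h4 := Real.exp_pos (2 * π * (1 / (3 * y)))
  have h5 : 0 < ‖etaG3A (((1 / (3 * y) : ℝ) : ℂ) * Complex.I)‖ :=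
    norm_pos_iff.mpr (G_ne (by simpa using h))
  rw [div_le_iff₀ (by simpa using h5)]
  rw [inv_le_iff_one_le_mul₀ h4] at h2
  simp only [norm_one, Complex.norm_ofNat]
  nlinarith

/-- Taylor coefficients of powers of `gU`. -/
noncomputable def Uc (k n : ℕ) : ℂ := (n.factorial : ℂ)⁻¹ * iteratedDeriv n (fun x => gU x ^ k) 0

/-- Coefficients of powers of `G`. -/
noncomputable def Bc (k m : ℕ) : ℂ := if m < k then 0 else Uc k (m - k)

lemma Uc_hasSum (k : ℕ) {x : ℂ} (h : ‖x‖ < 1) : HasSum (fun n => Uc k n * x ^ n) (gU x ^ k) := by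
  have := Complex.hasSum_taylorSeries_on_ball (f := fun x => gU x ^ k) (c := 0) (r := 1)
    (gU_diff.fun_pow k) (z := x) (by simpa using h)
  refine hs_congr this ?_
  intro n
  simp [Uc]
  ring

lemma Bc_hasSum (k : ℕ) {x : ℂ} (h : ‖x‖ < 1) : HasSum (fun n => Bc k n * x ^ n) (gF x ^ k) := by
  rw [← hasSum_nat_add_iff' k]
  have h0 : ∑ i ∈ Finset.range k, Bc k i * x ^ i = 0 := by
    refine Finset.sum_eq_zero fun i hi => ?_
    rw [Bc, if_pos (Finset.mem_range.mp hi), zero_mul]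
  rw [h0, sub_zero]
  have := (Uc_hasSum k h).mul_left (x ^ k)
  unfold gF
  rw [mul_pow]
  refine hs_congr this ?_
  intro n
  rw [Bc, if_neg (by omega), Nat.add_sub_cancel]
  ring

lemma Bc_lt {k m : ℕ} (h : m < k) : Bc k m = 0 := by rw [Bc, if_pos h]

lemma Bc_diag (k : ℕ) : Bc k k = 1 := by
  rw [Bc, if_neg (by omega), Nat.sub_self]
  simp [Uc, gU_zero]

lemma Uc_bound (k n : ℕ) {r : ℝ} (h0 : 0 < r) (h1 : r < 1) : ‖Uc k n‖ ≤ ‖gU r‖ ^ k / r ^ n := by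
  have hc : DiffContOnCl ℂ (fun x => gU x ^ k) (Metric.ball 0 r) := by
    refine DifferentiableOn.diffContOnCl (s := Metric.ball (0 : ℂ) r) ?_
    rw [closure_ball _ h0.ne']
    exact (gU_diff.fun_pow k).mono (Metric.closedBall_subset_ball h1)
  have := Complex.norm_iteratedDeriv_le_of_forall_mem_sphere_norm_le (c := 0) n h0 hc
    (C := ‖gU r‖ ^ k) (by
      intro z hz
      rw [norm_pow]
      exact pow_le_pow_left₀ (norm_nonneg _) (norm_gU_le (x := z) (r := r)
        (mem_sphere_zero_iff_norm.mp hz).le h1) _)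
  unfold Uc
  rw [norm_mul, norm_inv, Complex.norm_natCast]
  have hf : (0 : ℝ) < n.factorial := by exact_mod_cast n.factorial_pos
  rw [inv_mul_le_iff₀ hf]
  exact this.trans_eq (by ring)

lemma Bc_bound (k m : ℕ) {r : ℝ} (h0 : 0 < r) (h1 : r < 1) : ‖Bc k m‖ ≤ ‖gF r‖ ^ k / r ^ m := by
  by_cases h : m < k
  · rw [Bc_lt h, norm_zero]; positivity
  · rw [Bc, if_neg h]
    refine (Uc_bound k _ h0 h1).trans_eq ?_
    obtain ⟨l, rfl⟩ := Nat.exists_eq_add_of_le (not_lt.mp h)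
    rw [Nat.add_sub_cancel_left, gF, norm_mul, Complex.norm_real, Real.norm_of_nonneg h0.le]
    field_simp
    try ring

lemma Bc_bound' (m : ℕ) {y : ℝ} (h : 0 < y) :
    ‖Bc 1 m‖ ≤ Real.exp (2 * π * (1 / (3 * y) + m * y)) := by
  have h1 := Bc_bound 1 m (Real.exp_pos (-(2 * π * y))) (exp_lt h)
  have h2 := G_I_le h
  rw [etaG_eq, nome_I] at h2
  refine h1.trans ?_
  rw [pow_one, div_le_iff₀ (by positivity), ← Real.exp_nat_mul, ← Real.exp_add]
  refine h2.trans_eq ?_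
  congr 1
  ring

lemma puniq0 {a : ℕ → ℂ} (ha : ∀ x : ℂ, x ≠ 0 → ‖x‖ < 1 → HasSum (fun n => a n * x ^ n) 0) :
    a = 0 := by
  set f : ℂ → ℂ := fun x => ∑' n, a n * x ^ n with hf
  set p : FormalMultilinearSeries ℂ ℂ ℂ := FormalMultilinearSeries.ofScalars ℂ a with hp
  have h1 : HasFPowerSeriesAt f p 0 := by
    rw [hasFPowerSeriesAt_iff]
    filter_upwards [Metric.ball_mem_nhds (0 : ℂ) one_pos] with x hx
    have hx1 : ‖x‖ < 1 := by simpa using hx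
    have hs : Summable (fun n => a n * x ^ n) := by
      by_cases h : x = 0
      · refine summable_of_ne_finset_zero (s := {0}) ?_
        intro n hn
        rw [h, zero_pow (by simpa using hn), mul_zero]
      · exact (ha x h hx1).summable
    have := hs.hasSum
    simp only [hp, FormalMultilinearSeries.coeff_ofScalars, zero_add, smul_eq_mul, hf]
    exact hs_congr this (fun n => mul_comm _ _)
  have hz : ∀ᶠ x in 𝓝[≠] (0 : ℂ), f x = 0 := by
    filter_upwards [self_mem_nhdsWithin, mem_nhdsWithin_of_mem_nhds
      (Metric.ball_mem_nhds (0 : ℂ) one_pos)] with x h1 h2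
    exact (ha x h1 (by simpa using h2)).tsum_eq
  have hz2 : f =ᶠ[𝓝 0] 0 := h1.analyticAt.frequently_zero_iff_eventually_zero.mp hz.frequently
  have h3 := (h1.congr hz2).eq_zero
  funext n
  have := congrArg (fun q : FormalMultilinearSeries ℂ ℂ ℂ => q.coeff n) h3
  simp only [hp, FormalMultilinearSeries.coeff_ofScalars] at this
  rw [this]
  rfl

lemma puniq {a b : ℕ → ℂ} {f : ℂ → ℂ}
    (ha : ∀ x : ℂ, x ≠ 0 → ‖x‖ < 1 → HasSum (fun n => a n * x ^ n) (f x))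
    (hb : ∀ x : ℂ, x ≠ 0 → ‖x‖ < 1 → HasSum (fun n => b n * x ^ n) (f x)) : a = b := by
  have : a - b = 0 := puniq0 (a := a - b) (fun x h1 h2 => by
    have := (ha x h1 h2).sub (hb x h1 h2)
    simpa [sub_mul] using this)
  exact sub_eq_zero.mp this

end C3A

namespace C3A
open Filter Topology

/-- Index set of pairs `(j, d)`. -/
def hD (N : ℕ) : Finset (ℕ × ℕ) := (Nat.divisorsAntidiagonal N).filter (fun x => ¬ 3 ∣ x.1)

lemma mem_hD {N : ℕ} {x : ℕ × ℕ} : x ∈ hD N ↔ (x.1 * x.2 = N ∧ N ≠ 0) ∧ ¬ 3 ∣ x.1 := by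
  unfold hD
  simp [Nat.mem_divisorsAntidiagonal]

lemma hD_pos {N : ℕ} {x : ℕ × ℕ} (h : x ∈ hD N) : 0 < x.1 ∧ 0 < x.2 := by
  obtain ⟨⟨h1, h2⟩, -⟩ := mem_hD.mp h
  rw [← h1] at h2
  simp at h2
  omega

/-- Fourier coefficients of `hG`. -/
noncomputable def Ph (N m : ℕ) : ℂ :=
  ∑ x ∈ hD N, if x.1 ∣ m then (x.2 : ℂ) * Bc 1 (x.2 * (m / x.1)) else 0

lemma hG_eq (N : ℕ) (τ : ℂ) : hG N τ =
    ∑ x ∈ hD N, ∑ b ∈ Finset.range x.2, etaG3A ((x.1 * τ + b) / x.2) := by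
  unfold hG hS hD
  rw [Finset.sum_sigma]

lemma root_sum {d : ℕ} (hd : 0 < d) (n : ℕ) :
    ∑ b ∈ Finset.range d, nome ((b : ℂ) / d) ^ n = if d ∣ n then (d : ℂ) else 0 := by
  have hz : IsPrimitiveRoot (nome (1 / d)) d := by
    have := Complex.isPrimitiveRoot_exp d hd.ne'
    unfold nome
    rwa [mul_one_div]
  have e : ∀ b : ℕ, nome ((b : ℂ) / d) ^ n = (nome (1 / d) ^ n) ^ b := by
    intro b
    rw [show (b : ℂ) / d = b * (1 / d) by ring, nome_mul, ← pow_mul, ← pow_mul, mul_comm]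
  simp_rw [e]
  split_ifs with h
  · rw [(hz.pow_eq_one_iff_dvd n).mpr h]
    simp
  · have h1 : nome (1 / d) ^ n ≠ 1 := fun h' => h ((hz.pow_eq_one_iff_dvd n).mp h')
    rw [geom_sum_eq h1, ← pow_mul, mul_comm n d, pow_mul, hz.pow_eq_one, one_pow, sub_self, zero_div]

lemma G_hasSum {τ : ℂ} (h : 0 < τ.im) : HasSum (fun n => Bc 1 n * nome τ ^ n) (etaG3A τ) := by
  have := Bc_hasSum 1 (norm_nome_lt h)
  rwa [pow_one, ← etaG_eq] at this

lemma pair_hasSum {j d : ℕ} (hj : 0 < j) (hd : 0 < d) {τ : ℂ} (h : 0 < τ.im) :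
    HasSum (fun m : ℕ => (if j ∣ m then (d : ℂ) * Bc 1 (d * (m / j)) else 0) * nome τ ^ m)
      (∑ b ∈ Finset.range d, etaG3A ((j * τ + b) / d)) := by
  have hdc : (d : ℂ) ≠ 0 := by exact_mod_cast hd.ne'
  have h1 : HasSum (fun n : ℕ => ∑ b ∈ Finset.range d, Bc 1 n * nome ((j * τ + b) / d) ^ n)
      (∑ b ∈ Finset.range d, etaG3A ((j * τ + b) / d)) := by
    refine hasSum_sum fun b _ => G_hasSum ?_
    rw [Complex.div_natCast_im]
    simp
    positivity
  have h2 : HasSum (fun n : ℕ => Bc 1 n * nome (j * τ / d) ^ n * if d ∣ n then (d : ℂ) else 0)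
      (∑ b ∈ Finset.range d, etaG3A ((j * τ + b) / d)) := by
    refine hs_congr h1 fun n => ?_
    rw [← root_sum hd, Finset.mul_sum]
    refine Finset.sum_congr rfl fun b _ => ?_
    rw [add_div, nome_add, mul_pow]
    ring
  have h3 : HasSum (fun r : ℕ => (d : ℂ) * Bc 1 (d * r) * nome τ ^ (j * r))
      (∑ b ∈ Finset.range d, etaG3A ((j * τ + b) / d)) := by
    have hi : Function.Injective (fun r : ℕ => d * r) := fun a b hab => Nat.eq_of_mul_eq_mul_left hd hab
    rw [← hi.hasSum_iff] at h2
    · refine hs_congr h2 fun r => ?_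
      simp only [Function.comp]
      rw [if_pos (dvd_mul_right d r), pow_mul (nome (j * τ / d)), ← nome_mul d,
        mul_div_cancel₀ _ hdc, nome_mul, ← pow_mul]
      ring
    · intro n hn
      rw [if_neg, mul_zero]
      rintro ⟨r, rfl⟩
      exact hn ⟨r, rfl⟩
  have hi : Function.Injective (fun r : ℕ => j * r) := fun a b hab => Nat.eq_of_mul_eq_mul_left hj hab
  rw [← hi.hasSum_iff]
  · refine hs_congr h3 fun r => ?_
    simp only [Function.comp]
    rw [if_pos (dvd_mul_right j r), Nat.mul_div_cancel_left _ hj]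
  · intro n hn
    rw [if_neg, zero_mul]
    rintro ⟨r, rfl⟩
    exact hn ⟨r, rfl⟩

lemma hG_hasSum (N : ℕ) {τ : ℂ} (h : 0 < τ.im) :
    HasSum (fun m => Ph N m * nome τ ^ m) (hG N τ) := by
  rw [hG_eq]
  simp only [Ph, Finset.sum_mul]
  exact hasSum_sum fun x hx => pair_hasSum (hD_pos hx).1 (hD_pos hx).2 h

lemma Ph_symm_aux {N m : ℕ} (hm : 0 < m) : (m : ℂ) * Ph N m = ∑ j ∈ (Finset.range (N + m + 1)).filter
    (fun j => ¬ 3 ∣ j ∧ j ∣ N ∧ j ∣ m ∧ N ≠ 0),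
      (N : ℂ) * m / j * Bc 1 ((N / j) * (m / j)) := by
  unfold Ph
  rw [← Finset.sum_filter, Finset.mul_sum]
  refine Finset.sum_nbij' (fun x => x.1) (fun j => (j, N / j)) ?_ ?_ ?_ ?_ ?_
  · intro x hx
    rw [Finset.mem_filter, mem_hD] at hx
    obtain ⟨⟨⟨h1, h2⟩, h3⟩, h4⟩ := hx
    rw [Finset.mem_filter, Finset.mem_range]
    have h5 : x.1 ∣ N := ⟨x.2, h1.symm⟩
    have := Nat.le_of_dvd (by omega) h5
    exact ⟨by omega, h3, h5, h4, h2⟩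
  · intro j hj
    rw [Finset.mem_filter] at hj
    rw [Finset.mem_filter, mem_hD]
    obtain ⟨-, h3, h5, h4, h2⟩ := hj
    exact ⟨⟨⟨Nat.mul_div_cancel' h5, h2⟩, h3⟩, h4⟩
  · intro x hx
    rw [Finset.mem_filter, mem_hD] at hx
    obtain ⟨⟨⟨h1, h2⟩, h3⟩, h4⟩ := hx
    have : 0 < x.1 := Nat.pos_of_ne_zero (by rintro h; rw [h] at h1; simp at h1; omega)
    ext
    · rfl
    · simp only
      rw [← h1, Nat.mul_div_cancel_left _ this]
  · intro j hj
    rfl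
  · intro x hx
    rw [Finset.mem_filter, mem_hD] at hx
    obtain ⟨⟨⟨h1, h2⟩, h3⟩, h4⟩ := hx
    have : 0 < x.1 := Nat.pos_of_ne_zero (by rintro h; rw [h] at h1; simp at h1; omega)
    have hc : (x.1 : ℂ) ≠ 0 := by exact_mod_cast this.ne'
    rw [← h1, Nat.mul_div_cancel_left _ this]
    push_cast
    field_simp

lemma Ph_symm {N m : ℕ} (hN : 0 < N) (hm : 0 < m) : (m : ℂ) * Ph N m = N * Ph m N := by
  rw [Ph_symm_aux hm, Ph_symm_aux hN]
  refine Finset.sum_congr ?_ fun j _ => ?_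
  · ext j
    simp only [Finset.mem_filter, Finset.mem_range]
    constructor
    · rintro ⟨a, b, c, d, e⟩; exact ⟨by omega, b, d, c, by omega⟩
    · rintro ⟨a, b, c, d, e⟩; exact ⟨by omega, b, d, c, by omega⟩
  · rw [mul_comm (N / j), mul_comm (N : ℂ)]

lemma hG_T (N : ℕ) {τ : ℂ} (h : 0 < τ.im) : hG N (τ + 1) = hG N τ := by
  have h1 := hG_hasSum N (τ := τ + 1) (by simpa using h)
  have e : nome (τ + 1) = nome τ := by
    have := nome_add_int τ 1
    simpa using this
  rw [e] at h1
  exact h1.unique (hG_hasSum N h)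

lemma hG_diff (N : ℕ) : DifferentiableOn ℂ (hG N) {τ | 0 < τ.im} := by
  unfold hG
  refine DifferentiableOn.fun_sum fun z hz => ?_
  refine G_diff.comp (t := {τ | 0 < τ.im}) (f := fun τ : ℂ => (z.1.1 * τ + z.2) / z.1.2) (by fun_prop) ?_
  intro τ hτ
  exact hS_im_pos hz hτ

lemma hG_tendsto (N : ℕ) : Tendsto (hG N) iInf (𝓝 0) := by
  unfold hG
  rw [← Finset.sum_const_zero (s := hS N)]
  refine tendsto_finsetSum _ fun z hz => ?_
  refine G_tendsto.comp (f := fun τ : ℂ => (z.1.1 * τ + z.2) / z.1.2) ?_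
  unfold iInf
  rw [tendsto_comap_iff]
  have e : (Complex.im ∘ fun τ : ℂ => (z.1.1 * τ + z.2) / z.1.2) = fun τ : ℂ => (z.1.1 : ℝ) / z.1.2 * τ.im := by
    funext τ
    exact hS_im hz
  rw [e]
  obtain ⟨h1, h2⟩ := hS_pos hz
  exact tendsto_comap.const_mul_atTop (by positivity)

lemma hG_W (N : ℕ) {τ : ℂ} (h : 0 < τ.im) : hG N (-1 / (3 * (τ + 1))) = hG N (-1 / (3 * τ)) := by
  have h1 : 0 < (τ + 1).im := by simpa using h
  have h2 := hG_V N (W_pos h1)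
  rw [← h2]
  congr 1
  have a := ne_of_im h
  have b := ne_of_im h1
  have c : -1 / (τ + 1) + 1 ≠ 0 := by
    rw [show -1 / (τ + 1) + 1 = τ / (τ + 1) by field_simp; ring]
    exact div_ne_zero a b
  rw [show 3 * (-1 / (3 * (τ + 1))) + 1 = τ / (τ + 1) by field_simp; ring]
  field_simp

lemma hG_bound (N : ℕ) {t : ℂ} (h : 1 ≤ t.im) (hr : |t.re| ≤ 1 / 2) :
    ‖hG N (-1 / (3 * t))‖ ≤ (hS N).card * Real.exp (2 * π * (N * (t.im + 1))) := by
  have ht : 0 < t.im := by linarith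
  unfold hG
  rw [← nsmul_eq_mul]
  refine (norm_sum_le _ _).trans (Finset.sum_le_card_nsmul _ _ _ fun z hz => ?_)
  have h1 := hS_im_pos hz (W_pos ht)
  obtain ⟨hj, hd⟩ := hS_pos hz
  refine (norm_G_le h1 le_rfl).trans ((G_I_le h1).trans ?_)
  rw [Real.exp_le_exp, hS_im hz, W_im]
  have hpi := Real.pi_pos
  refine mul_le_mul_of_nonneg_left ?_ (by positivity)
  have hn := normSq_pos' ht
  have hn2 : Complex.normSq t ≤ t.im * (t.im + 1) := by
    rw [Complex.normSq_apply]
    have := abs_le.mp hr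
    nlinarith
  have hdN : (z.1.2 : ℝ) ≤ N * z.1.1 := by
    have := (mem_hS.mp hz).1
    have h3 : z.1.2 ≤ N * z.1.1 := by
      rw [← this]; nlinarith
    exact_mod_cast h3
  have hjr : (0 : ℝ) < z.1.1 := by exact_mod_cast hj
  have hdr : (0 : ℝ) < z.1.2 := by exact_mod_cast hd
  rw [show 1 / (3 * ((z.1.1 : ℝ) / z.1.2 * (t.im / (3 * Complex.normSq t)))) =
    z.1.2 * Complex.normSq t / (z.1.1 * t.im) by field_simp]
  rw [div_le_iff₀ (by positivity)]
  calc (z.1.2 : ℝ) * Complex.normSq t ≤ (N * z.1.1) * (t.im * (t.im + 1)) := by gcongr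
    _ = _ := by ring

lemma hG_growth (N : ℕ) :
    (fun t => hG N (-1 / (3 * t)) * etaG3A t ^ N) =O[iInf] (fun _ => (1 : ℂ)) := by
  have hU : ∀ᶠ t in iInf, ‖gU (nome t)‖ < 2 := by
    have := gU_tendsto.norm
    rw [norm_one] at this
    exact this.eventually (gt_mem_nhds (by norm_num))
  refine Asymptotics.IsBigO.of_bound ((hS N).card * Real.exp (2 * π * N) * 2 ^ N) ?_
  filter_upwards [hU, ev_im 1] with t h1 h2
  have ht : 0 < t.im := by linarith
  have hper := per_int (f := fun t => hG N (-1 / (3 * t))) (fun τ h => hG_W N h) (-round t.re) t ht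
  have hre : |(t + ((-round t.re : ℤ) : ℂ)).re| ≤ 1 / 2 := by
    have := abs_sub_round t.re
    simpa [sub_eq_add_neg] using this
  have hb := hG_bound N (t := t + ((-round t.re : ℤ) : ℂ)) (by rw [add_int_im]; exact h2.le) hre
  rw [hper, add_int_im] at hb
  rw [norm_mul, norm_pow, etaG_eq, gF, norm_mul, norm_nome, norm_one, mul_one]
  calc _ ≤ ((hS N).card * Real.exp (2 * π * (N * (t.im + 1)))) * (Real.exp (-(2 * π * t.im)) * 2) ^ N := by
        refine mul_le_mul hb ?_ (by positivity) (by positivity)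
        refine pow_le_pow_left₀ (by positivity) ?_ _
        exact mul_le_mul_of_nonneg_left h1.le (Real.exp_pos _).le
    _ = (hS N).card * (Real.exp (2 * π * (N * (t.im + 1))) * Real.exp (N * (-(2 * π * t.im)))) * 2 ^ N := by
        rw [mul_pow, ← Real.exp_nat_mul]; ring
    _ = _ := by
        rw [← Real.exp_add]
        congr 3
        ring

lemma hG_poly (N : ℕ) : ∃ c : ℕ → ℂ, ∀ τ : ℂ, 0 < τ.im →
    hG N τ = ∑ k ∈ Finset.Icc 1 N, c k * etaG3A τ ^ k :=
  lemB N (hG_diff N) (fun _ h => hG_T N h) (fun _ h => hG_W N h) (hG_tendsto N) (hG_growth N)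

/-- polynomial coefficients -/
noncomputable def Tc (N : ℕ) : ℕ → ℂ := (hG_poly N).choose

lemma Tc_spec (N : ℕ) {τ : ℂ} (h : 0 < τ.im) :
    hG N τ = ∑ k ∈ Finset.Icc 1 N, Tc N k * etaG3A τ ^ k := (hG_poly N).choose_spec τ h

lemma Ph_eq (N m : ℕ) : Ph N m = ∑ k ∈ Finset.Icc 1 N, Tc N k * Bc k m := by
  have : Ph N = fun m => ∑ k ∈ Finset.Icc 1 N, Tc N k * Bc k m := by
    refine puniq (f := fun x => ∑' m, Ph N m * x ^ m) ?_ ?_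
    · intro x h0 h1
      obtain ⟨τ, hτ, rfl⟩ := exists_nome h0 h1
      exact (hG_hasSum N hτ).summable.hasSum
    · intro x h0 h1
      obtain ⟨τ, hτ, rfl⟩ := exists_nome h0 h1
      beta_reduce
      rw [(hG_hasSum N hτ).tsum_eq, Tc_spec N hτ]
      simp only [Finset.sum_mul]
      refine hasSum_sum fun k _ => ?_
      have := (Bc_hasSum k (norm_nome_lt hτ)).mul_left (Tc N k)
      rw [etaG_eq]
      exact hs_congr this fun n => by ring
  rw [this]

/-- diagonal coefficients -/
noncomputable def Cc (k : ℕ) : ℂ := Tc k k / k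

lemma Tc_diag (k : ℕ) : ∀ N, 1 ≤ k → k ≤ N → Tc N k = N * (Cc k * Bc k N) := by
  induction k using Nat.strong_induction_on with
  | _ k ih =>
  intro N hk hN
  have hs := Ph_symm (N := N) (m := k) (by omega) (by omega)
  have e1 : Ph N k = ∑ l ∈ Finset.Icc 1 k, Tc N l * Bc l k := by
    rw [Ph_eq]
    symm
    refine Finset.sum_subset (Finset.Icc_subset_Icc_right hN) fun l h1 h2 => ?_
    rw [Finset.mem_Icc] at h1 h2
    rw [Bc_lt (by omega), mul_zero]
  rw [e1, Ph_eq k N] at hs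
  obtain ⟨k, rfl⟩ : ∃ k', k = k' + 1 := ⟨k - 1, by omega⟩
  rw [Finset.sum_Icc_succ_top (by omega), Finset.sum_Icc_succ_top (by omega), Bc_diag, mul_add,
    mul_add] at hs
  have e2 : ((k + 1 : ℕ) : ℂ) * ∑ l ∈ Finset.Icc 1 k, Tc N l * Bc l (k + 1) =
      N * ∑ l ∈ Finset.Icc 1 k, Tc (k + 1) l * Bc l N := by
    rw [Finset.mul_sum, Finset.mul_sum]
    refine Finset.sum_congr rfl fun l hl => ?_
    rw [Finset.mem_Icc] at hl
    rw [ih l (by omega) N hl.1 (by omega), ih l (by omega) (k + 1) hl.1 (by omega)]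
    ring
  rw [e2] at hs
  have hs2 := add_left_cancel hs
  have hk0 : ((k + 1 : ℕ) : ℂ) ≠ 0 := by exact_mod_cast (Nat.succ_ne_zero k)
  rw [mul_one] at hs2
  unfold Cc
  apply mul_left_cancel₀ hk0
  rw [hs2]
  field_simp

end C3A

namespace C3A
open Filter Topology

lemma zeta_lt {z : ℂ} (h1 : ‖z‖ = 1) (hne : z ≠ 1) : ‖1 + z + z ^ 2‖ < 3 := by
  have h2 : ‖1 + z‖ < 2 := by
    have hs : z.re * z.re + z.im * z.im = 1 := by
      rw [← Complex.normSq_apply, Complex.normSq_eq_norm_sq, h1, one_pow]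
    have hre : z.re < 1 := by
      by_contra hc
      push Not at hc
      have : z.im = 0 := by nlinarith [sq_nonneg z.im]
      have h3 : z.re = 1 := by nlinarith
      exact hne (Complex.ext (by simpa using h3) (by simpa using this))
    have : ‖1 + z‖ ^ 2 < 2 ^ 2 := by
      rw [← Complex.normSq_eq_norm_sq, Complex.normSq_apply]
      simp
      nlinarith
    exact lt_of_pow_lt_pow_left₀ 2 (by norm_num) this
  calc ‖1 + z + z ^ 2‖ ≤ ‖1 + z‖ + ‖z ^ 2‖ := norm_add_le _ _
    _ < 2 + 1 := by rw [norm_pow, h1]; linarith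
    _ = 3 := by norm_num

lemma pU_one (K : ℕ) : ‖pU 1 K‖ = 3 ^ K := by
  unfold pU
  simp
  norm_num

lemma pU_small {z : ℂ} {N : ℕ} (hN : 0 < N) (h1 : ‖z‖ = 1) (hne : z ≠ 1) (hz : z ^ N = 1) :
    Tendsto (fun M => ‖pU z (N * M)‖ / ‖pU 1 (N * M)‖) atTop (𝓝 0) := by
  have e : ∀ M, pU z (N * M) = pU z N ^ M := by
    intro M
    induction M with
    | zero => simp [pU]
    | succ M ih =>
      rw [pow_succ, ← ih]
      unfold pU
      rw [mul_add, mul_one, Finset.prod_range_add]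
      congr 1
      refine Finset.prod_congr rfl fun i _ => ?_
      rw [show N * M + i + 1 = N * M + (i + 1) by ring, pow_add z (N * M), pow_mul, hz, one_pow, one_mul]
  have hlt : ‖pU z N‖ < 3 ^ N := by
    obtain ⟨N', rfl⟩ : ∃ k, N = k + 1 := ⟨N - 1, by omega⟩
    unfold pU
    rw [Finset.prod_range_succ', norm_mul, norm_prod, pow_succ]
    refine lt_of_le_of_lt (mul_le_mul_of_nonneg_right (?_ : _ ≤ ∏ i ∈ Finset.range N', (3 : ℝ)) (norm_nonneg _)) ?_
    · refine Finset.prod_le_prod (fun _ _ => norm_nonneg _) fun i _ => ?_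
      refine (fac_le h1.le _).trans ?_
      norm_num
    · simp only [Finset.prod_const, Finset.card_range, zero_add, pow_one]
      refine mul_lt_mul_of_pos_left ?_ (by positivity)
      have := zeta_lt h1 hne
      simpa using this
  have : (fun M => ‖pU z (N * M)‖ / ‖pU 1 (N * M)‖) = fun M => (‖pU z N‖ / 3 ^ N) ^ M := by
    funext M
    rw [e, norm_pow, pU_one, pow_mul, div_pow]
  rw [this]
  refine tendsto_pow_atTop_nhds_zero_of_lt_one (by positivity) ?_
  rw [div_lt_one (by positivity)]
  exact hlt

lemma pU_cont (K : ℕ) : Continuous (fun x => pU x K) := by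
  unfold pU
  fun_prop

lemma gU_ratio {z : ℂ} {N : ℕ} (hN : 0 < N) (h1 : ‖z‖ = 1) (hne : z ≠ 1) (hz : z ^ N = 1)
    {r : ℝ → ℝ} (hr0 : ∀ᶠ u in atTop, 0 < r u) (hr1 : ∀ᶠ u in atTop, r u < 1)
    (hr : Tendsto r atTop (𝓝 1)) :
    Tendsto (fun u => gU (r u * z) / gU (r u)) atTop (𝓝 0) := by
  have hc : Tendsto (fun u => ((r u : ℝ) : ℂ)) atTop (𝓝 1) := by
    have := (Complex.continuous_ofReal.tendsto 1).comp hr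
    rw [Complex.ofReal_one] at this
    exact this
  have key : Tendsto (fun u => ‖gE ((r u * z) ^ 3) / gE (r u * z)‖ / ‖gE ((r u : ℂ) ^ 3) / gE (r u)‖)
      atTop (𝓝 0) := by
    rw [Metric.tendsto_nhds]
    intro ε hε
    obtain ⟨M, hM⟩ := ((pU_small hN h1 hne hz).eventually (gt_mem_nhds hε)).exists
    have ht : Tendsto (fun u => ‖pU (r u * z) (N * M)‖ / ‖pU (r u) (N * M)‖) atTop
        (𝓝 (‖pU z (N * M)‖ / ‖pU 1 (N * M)‖)) := by
      refine Tendsto.div ?_ ?_ ?_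
      · have := ((pU_cont (N * M)).tendsto (1 * z)).comp (hc.mul_const z)
        rw [one_mul] at this
        exact this.norm
      · exact (((pU_cont (N * M)).tendsto 1).comp hc).norm
      · rw [pU_one]; positivity
    filter_upwards [ht.eventually (gt_mem_nhds hM), hr0, hr1] with u hu h0 h1'
    rw [Real.dist_eq, sub_zero, abs_of_nonneg (by positivity)]
    refine lt_of_le_of_lt ?_ hu
    have hn : ‖(r u : ℂ)‖ < 1 := by rwa [Complex.norm_real, Real.norm_of_nonneg h0.le]
    have hq : 0 < ‖gE ((r u : ℂ) ^ 3) / gE (r u)‖ :=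
      norm_pos_iff.mpr (div_ne_zero (gE_ne (pow_lt hn (by norm_num))) (gE_ne hn))
    have hp : 0 < ‖pU (r u) (N * M)‖ := by
      unfold pU
      rw [norm_prod]
      refine Finset.prod_pos fun i _ => ?_
      rw [norm_fac h0.le]
      positivity
    rw [div_le_div_iff₀ hq hp]
    refine gQ_le ?_ h1' _
    rw [norm_mul, h1, mul_one, Complex.norm_real, Real.norm_of_nonneg h0.le]
  rw [tendsto_zero_iff_norm_tendsto_zero]
  have := key.pow 12
  rw [zero_pow (by norm_num)] at this
  refine this.congr fun u => ?_
  rw [norm_div (gU _), gU_norm, gU_norm, div_pow]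

lemma GI_ev {c : ℝ} (hc : 0 < c) : Tendsto (fun u : ℝ => gU (nome ((c * u : ℝ) * Complex.I))) atTop (𝓝 1) := by
  refine gU_tendsto.comp ?_
  unfold iInf
  rw [tendsto_comap_iff]
  have : (Complex.im ∘ fun u : ℝ => ((c * u : ℝ) : ℂ) * Complex.I) = fun u => c * u := by
    funext u; simp
  rw [this]
  exact tendsto_id.const_mul_atTop hc

lemma lead1 {N : ℕ} (hN : 0 < N) : Tendsto (fun u : ℝ =>
    etaG3A (((1 / (3 * (N * u)) : ℝ) : ℂ) * Complex.I) / etaG3A (((1 / (3 * u) : ℝ) : ℂ) * Complex.I) ^ N)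
    atTop (𝓝 (729 ^ (N - 1))) := by
  have hNr : (0 : ℝ) < N := by exact_mod_cast hN
  have h1 := GI_ev one_pos
  have h2 := GI_ev hNr
  have h3 := ((h1.pow N).div h2 one_ne_zero).const_mul (729 ^ (N - 1) : ℂ)
  simp only [one_pow, div_one, mul_one] at h3
  refine h3.congr' ?_
  filter_upwards [eventually_gt_atTop 0] with u hu
  have hu' : 0 < N * u := by positivity
  rw [fricke_I hu', fricke_I hu]
  have g1 := G_ne (τ := u * Complex.I) (by simpa using hu)
  have g2 := G_ne (τ := ((N * u : ℝ) : ℂ) * Complex.I) (by simpa using hu')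
  have e1 : etaG3A (u * Complex.I) = nome (u * Complex.I) * gU (nome (u * Complex.I)) := etaG_eq _
  have e2 : etaG3A (((N * u : ℝ) : ℂ) * Complex.I) =
      nome (u * Complex.I) ^ N * gU (nome (((N * u : ℝ) : ℂ) * Complex.I)) := by
    rw [etaG_eq, gF, ← nome_mul]
    congr 2
    push_cast; ring
  have k1 := gU_ne (norm_nome_lt (τ := ((N * u : ℝ) : ℂ) * Complex.I) (by simpa using hu'))
  simp only [Pi.div_apply, one_mul]
  rw [e1, e2]
  have k2 := nome_ne (u * Complex.I)
  have k3 := gU_ne (norm_nome_lt (τ := u * Complex.I) (by simpa using hu))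
  obtain ⟨M, rfl⟩ : ∃ k, N = k + 1 := ⟨N - 1, by omega⟩
  rw [Nat.add_sub_cancel, one_div, one_div, inv_pow, mul_pow, mul_pow]
  field_simp
  ring

lemma lead_j {N : ℕ} {j d b : ℕ} (hjd : j * d = N) (hN : 0 < N) (hj : 2 ≤ j) : Tendsto (fun u : ℝ =>
    etaG3A ((j * (((1 / (3 * u) : ℝ) : ℂ) * Complex.I) + b) / d) /
      etaG3A (((1 / (3 * (N * u)) : ℝ) : ℂ) * Complex.I)) atTop (𝓝 0) := by
  have hNr : (0 : ℝ) < N := by exact_mod_cast hN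
  have hd : 0 < d := Nat.pos_of_ne_zero (by rintro rfl; simp at hjd; omega)
  have hjr : (0 : ℝ) < j := by positivity
  have hdr : (0 : ℝ) < d := by positivity
  have hlt : 0 < (N : ℝ) - d / j := by
    rw [sub_pos, div_lt_iff₀ hjr]
    have : d < N * j := by rw [← hjd]; nlinarith
    exact_mod_cast this
  rw [tendsto_zero_iff_norm_tendsto_zero]
  have h2 : ∀ᶠ u : ℝ in atTop, ‖gU (nome ((N * u : ℝ) * Complex.I))‖ < 2 := by
    have := (GI_ev hNr).norm
    rw [norm_one] at this
    exact this.eventually (gt_mem_nhds (by norm_num))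
  have hlim : Tendsto (fun u : ℝ => 2 * Real.exp (-(2 * π * ((N - d / j) * u)))) atTop (𝓝 0) := by
    have h3 : Tendsto (fun u : ℝ => 2 * π * ((N - d / j) * u)) atTop atTop :=
      (tendsto_id.const_mul_atTop hlt).const_mul_atTop (by positivity)
    have := (Real.tendsto_exp_neg_atTop_nhds_zero.comp h3).const_mul 2
    simpa using this
  refine squeeze_zero' (Eventually.of_forall fun _ => norm_nonneg _) ?_ hlim
  filter_upwards [h2, eventually_gt_atTop 0] with u hu h0
  have h0' : 0 < N * u := by positivity
  have hdu : 0 < d / j * u := by positivity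
  have him : ((j * (((1 / (3 * u) : ℝ) : ℂ) * Complex.I) + b) / d).im = 1 / (3 * (d / j * u)) := by
    rw [Complex.div_natCast_im]
    simp
    field_simp
  have hn := norm_G_le (y := 1 / (3 * (d / j * u))) (by positivity) him.ge
  rw [fricke_I hdu] at hn
  rw [fricke_I h0', norm_div]
  have g1 := G_ne (τ := ((N * u : ℝ) : ℂ) * Complex.I) (by simpa using h0')
  have g2 := G_I_ge hdu
  have g3 : 0 < ‖etaG3A (((d / j * u : ℝ) : ℂ) * Complex.I)‖ := (Real.exp_pos _).trans_le g2
  have g4 : 0 < ‖etaG3A (((N * u : ℝ) : ℂ) * Complex.I)‖ := norm_pos_iff.mpr g1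
  rw [norm_div, norm_mul, norm_one] at hn ⊢
  have e : ‖(729 : ℂ)‖ = 729 := by simp
  rw [e] at hn ⊢
  have g5 : ‖etaG3A (((N * u : ℝ) : ℂ) * Complex.I)‖ ≤ 2 * Real.exp (-(2 * π * (N * u))) := by
    rw [etaG_eq, gF, norm_mul, nome_I, Complex.norm_real, Real.norm_of_nonneg (Real.exp_pos _).le, mul_comm]
    rw [nome_I] at hu
    exact mul_le_mul_of_nonneg_right hu.le (Real.exp_pos _).le
  calc _ ≤ (1 / (729 * ‖etaG3A (((d / j * u : ℝ) : ℂ) * Complex.I)‖)) /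
        (1 / (729 * ‖etaG3A (((N * u : ℝ) : ℂ) * Complex.I)‖)) := by gcongr
    _ = ‖etaG3A (((N * u : ℝ) : ℂ) * Complex.I)‖ / ‖etaG3A (((d / j * u : ℝ) : ℂ) * Complex.I)‖ := by
        field_simp
    _ ≤ (2 * Real.exp (-(2 * π * (N * u)))) / Real.exp (-(2 * π * (d / j * u))) := by gcongr
    _ = _ := by
        rw [mul_div_assoc, ← Real.exp_sub]
        congr 2
        ring

lemma lead_b {N b : ℕ} (hb : 0 < b) (hbN : b < N) : Tendsto (fun u : ℝ =>
    etaG3A (((1 : ℕ) * (((1 / (3 * u) : ℝ) : ℂ) * Complex.I) + b) / N) /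
      etaG3A (((1 / (3 * (N * u)) : ℝ) : ℂ) * Complex.I)) atTop (𝓝 0) := by
  have hN : 0 < N := by omega
  have hNr : (0 : ℝ) < N := by exact_mod_cast hN
  have hNc : (N : ℂ) ≠ 0 := by exact_mod_cast hN.ne'
  set z : ℂ := nome ((b : ℂ) / N) with hz
  have hz1 : ‖z‖ = 1 := by rw [hz, norm_nome, Complex.div_natCast_im]; simp
  have hzN : z ^ N = 1 := by
    rw [hz, ← nome_mul, mul_div_cancel₀ _ hNc]
    exact nome_int b
  have hzne : z ≠ 1 := by
    have hp := Complex.isPrimitiveRoot_exp N hN.ne'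
    have : z = Complex.exp (2 * π * Complex.I / N) ^ b := by
      rw [hz, ← Complex.exp_nat_mul]
      unfold nome
      congr 1
      ring
    rw [this]
    exact hp.pow_ne_one_of_pos_of_lt hb.ne' hbN
  have hr : Tendsto (fun u : ℝ => Real.exp (-(2 * π * (1 / (3 * (N * u)))))) atTop (𝓝 1) := by
    have h1 : Tendsto (fun u : ℝ => 1 / (3 * (N * u))) atTop (𝓝 0) := by
      refine Tendsto.div_atTop tendsto_const_nhds ?_
      exact (tendsto_id.const_mul_atTop hNr).const_mul_atTop (by norm_num)
    have h2 := (h1.const_mul (2 * π)).neg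
    have h3 := (Real.continuous_exp.tendsto _).comp h2
    rw [mul_zero, neg_zero, Real.exp_zero] at h3
    exact h3
  have hmain := (gU_ratio hN hz1 hzne hzN (Eventually.of_forall fun _ => Real.exp_pos _) ?_ hr).mul_const z
  · rw [zero_mul] at hmain
    refine hmain.congr' ?_
    filter_upwards [eventually_gt_atTop 0] with u hu
    rw [etaG_eq, etaG_eq]
    have e : nome (((1 : ℕ) * (((1 / (3 * u) : ℝ) : ℂ) * Complex.I) + b) / N) =
        (Real.exp (-(2 * π * (1 / (3 * (N * u))))) : ℝ) * z := by
      rw [← nome_I, hz, ← nome_add]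
      congr 1
      have : (u : ℂ) ≠ 0 := by exact_mod_cast hu.ne'
      push_cast
      field_simp
    rw [e, nome_I]
    unfold gF
    have k1 : ((Real.exp (-(2 * π * (1 / (3 * (N * u))))) : ℝ) : ℂ) ≠ 0 := by
      exact_mod_cast (Real.exp_pos _).ne'
    generalize ((Real.exp (-(2 * π * (1 / (3 * (N * u))))) : ℝ) : ℂ) = R at k1 ⊢
    rw [mul_assoc R, mul_div_mul_left _ _ k1]
    ring
  · filter_upwards [eventually_gt_atTop 0] with u hu
    exact exp_lt (by positivity)

lemma lead_limit {N : ℕ} (hN : 0 < N) : Tendsto (fun u : ℝ =>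
    hG N (((1 / (3 * u) : ℝ) : ℂ) * Complex.I) /
      etaG3A (((1 / (3 * (N * u)) : ℝ) : ℂ) * Complex.I)) atTop (𝓝 1) := by
  have hlim : ∀ z ∈ hS N, Tendsto (fun u : ℝ =>
      etaG3A ((z.1.1 * (((1 / (3 * u) : ℝ) : ℂ) * Complex.I) + z.2) / z.1.2) /
        etaG3A (((1 / (3 * (N * u)) : ℝ) : ℂ) * Complex.I)) atTop
        (𝓝 (if z = ⟨(1, N), 0⟩ then 1 else 0)) := by
    rintro ⟨⟨j, d⟩, b⟩ hz
    obtain ⟨h1, h2, h3, h4⟩ := mem_hS.mp hz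
    simp only at h1 h2 h3 h4
    have hj0 : j ≠ 0 := by rintro rfl; simp at h3
    by_cases hj : j = 1
    · subst hj
      rw [one_mul] at h1
      subst h1
      by_cases hb : b = 0
      · subst hb
        rw [if_pos rfl]
        refine tendsto_const_nhds.congr' ?_
        filter_upwards [eventually_gt_atTop 0] with u hu
        have hp2 : 0 < (((1 / (3 * (d * u)) : ℝ) : ℂ) * Complex.I).im := by
          have : 0 < 1 / (3 * (d * u)) := by positivity
          simpa using this
        have huc : (u : ℂ) ≠ 0 := by exact_mod_cast hu.ne'
        have hdc : (d : ℂ) ≠ 0 := by exact_mod_cast hN.ne'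
        rw [show (((1 : ℕ) : ℂ) * (((1 / (3 * u) : ℝ) : ℂ) * Complex.I) + (0 : ℕ)) / d =
          ((1 / (3 * (d * u)) : ℝ) : ℂ) * Complex.I by push_cast; field_simp; ring,
          div_self (G_ne hp2)]
      · rw [if_neg (by simpa using hb)]
        exact lead_b (Nat.pos_of_ne_zero hb) h4
    · rw [if_neg (by simp [hj])]
      have hj2 : 2 ≤ j := by omega
      exact lead_j h1 hN hj2
  have h := tendsto_finsetSum _ hlim
  rw [Finset.sum_ite_eq' , if_pos (mem_hS.mpr ⟨by simp, by omega, by simp, hN⟩)] at h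
  refine h.congr fun u => ?_
  rw [hG, Finset.sum_div]

lemma Tc_lead {N : ℕ} (hN : 0 < N) : Tc N N = 729 ^ (N - 1) := by
  have h1 := (lead_limit hN).mul (lead1 hN)
  rw [one_mul] at h1
  refine tendsto_nhds_unique ?_ h1
  have hinv : Tendsto (fun u : ℝ => (etaG3A (((1 / (3 * u) : ℝ) : ℂ) * Complex.I))⁻¹) atTop (𝓝 0) := by
    have h2 : Tendsto (fun u : ℝ => 729 * etaG3A (u * Complex.I)) atTop (𝓝 (729 * 0)) := by
      refine Tendsto.const_mul _ (G_tendsto.comp ?_)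
      unfold iInf
      rw [tendsto_comap_iff]
      have : (Complex.im ∘ fun u : ℝ => (u : ℂ) * Complex.I) = fun u => u := by
        funext u; simp
      rw [this]
      exact tendsto_id
    rw [mul_zero] at h2
    refine h2.congr' ?_
    filter_upwards [eventually_gt_atTop 0] with u hu
    rw [fricke_I hu, one_div, inv_inv]
  have h3 : Tendsto (fun u : ℝ => ∑ k ∈ Finset.Icc 1 N, Tc N k *
      ((etaG3A (((1 / (3 * u) : ℝ) : ℂ) * Complex.I))⁻¹) ^ (N - k)) atTop
      (𝓝 (∑ k ∈ Finset.Icc 1 N, Tc N k * 0 ^ (N - k))) :=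
    tendsto_finsetSum _ fun k _ => (hinv.pow _).const_mul _
  have h4 : ∑ k ∈ Finset.Icc 1 N, Tc N k * 0 ^ (N - k) = Tc N N := by
    rw [Finset.sum_eq_single_of_mem N (by simp; omega)]
    · simp
    · intro k hk hne
      rw [Finset.mem_Icc] at hk
      rw [zero_pow (by omega), mul_zero]
  rw [h4] at h3
  refine h3.congr' ?_
  filter_upwards [eventually_gt_atTop 0] with u hu
  have hp : 0 < (((1 / (3 * u) : ℝ) : ℂ) * Complex.I).im := by simpa using hu
  have hp2 : 0 < (((1 / (3 * (N * u)) : ℝ) : ℂ) * Complex.I).im := by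
    have : 0 < 1 / (3 * (N * u)) := by positivity
    simpa using this
  have g := G_ne hp
  have g2 := G_ne hp2
  rw [div_mul_div_cancel₀ g2, Tc_spec N hp, Finset.sum_div]
  refine Finset.sum_congr rfl fun k hk => ?_
  rw [Finset.mem_Icc] at hk
  rw [mul_div_assoc]
  congr 1
  rw [inv_pow, eq_div_iff (pow_ne_zero _ g), inv_mul_eq_iff_eq_mul₀ (pow_ne_zero _ g), ← pow_add]
  congr 1
  omega

lemma Cc_eq {N : ℕ} (hN : 0 < N) : Cc N = 729 ^ (N - 1) / N := by
  rw [Cc, Tc_lead hN]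

end C3A

namespace C3A
open Filter Topology

lemma gE_deriv : HasDerivAt gE (-1) 0 := by
  have hd : DifferentiableAt ℂ gE 0 := gE_diff.differentiableAt (Metric.ball_mem_nhds 0 one_pos)
  have hl : ∀ n : ℕ, logDeriv (fun q : ℂ => 1 - q ^ (n + 1)) 0 = if n = 0 then -1 else 0 := by
    intro n
    have : HasDerivAt (fun q : ℂ => 1 - q ^ (n + 1)) (-(((n + 1 : ℕ) : ℂ) * 0 ^ n)) 0 := by
      simpa using (hasDerivAt_pow (n + 1) (0 : ℂ)).const_sub 1
    rw [logDeriv_apply, this.deriv]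
    split_ifs with h
    · subst h; simp
    · simp [h]
  have h := logDeriv_tprod_eq_tsum (s := Metric.ball (0 : ℂ) 1) Metric.isOpen_ball (x := 0)
    (by simp) (f := fun n q => 1 - q ^ (n + 1)) (by intro i; simp) (by intro i; fun_prop)
    (by
      simp only [hl]
      refine summable_of_ne_finset_zero (s := {0}) ?_
      intro n hn
      rw [if_neg (by simpa using hn)])
    ModularForm.multipliableLocallyUniformlyOn_one_sub_pow (by simp)
  simp only [hl, tsum_ite_eq] at h
  have e : (fun q : ℂ => ∏' n : ℕ, (1 - q ^ (n + 1))) = gE := rfl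
  rw [e, logDeriv_apply, gE_zero, div_one] at h
  rw [← h]
  exact hd.hasDerivAt

lemma gU_deriv : HasDerivAt gU 12 0 := by
  have h3 : HasDerivAt (fun x : ℂ => gE (x ^ 3)) 0 0 := by
    have h1 : HasDerivAt (fun x : ℂ => x ^ 3) 0 0 := by
      simpa using hasDerivAt_pow 3 (0 : ℂ)
    have h2 : HasDerivAt gE (-1) ((fun x : ℂ => x ^ 3) 0) := by simpa using gE_deriv
    have := HasDerivAt.comp (0 : ℂ) h2 h1
    rw [mul_zero] at this
    exact this
  have h4 := (h3.fun_div gE_deriv (by simp [gE_zero])).fun_pow 12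
  unfold gU
  simpa [gE_zero] using h4

lemma Bc12 : Bc 1 2 = 12 := by
  rw [Bc, if_neg (by omega)]
  simp [Uc, gU_deriv.deriv]

/-- odd part -/
noncomputable def gO (x : ℂ) : ℂ := ∏' n : ℕ, (1 - x ^ (2 * n + 1))

lemma gO_mult {x : ℂ} (h : ‖x‖ < 1) : Multipliable (fun n : ℕ => 1 - x ^ (2 * n + 1)) := by
  simp only [sub_eq_add_neg]
  refine multipliable_one_add_of_summable (f := fun n : ℕ => -x ^ (2 * n + 1)) ?_
  simp only [norm_neg, norm_pow]
  have h1 : Summable (fun n : ℕ => ‖x‖ ^ n) := summable_geometric_of_lt_one (norm_nonneg _) h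
  exact h1.comp_injective (i := fun n : ℕ => 2 * n + 1) (fun a b hab => by simpa using hab)

lemma gE_split {x : ℂ} (h : ‖x‖ < 1) : gE x = gO x * gE (x ^ 2) := by
  have := tprod_even_mul_odd (f := fun n : ℕ => 1 - x ^ (n + 1)) (gO_mult h) (by
    have := gE_mult (pow_lt h (n := 2) (by norm_num))
    refine this.congr fun n => ?_
    rw [← pow_mul]
    congr 2)
  unfold gE gO
  rw [← this]
  congr 1
  refine tprod_congr fun n => ?_
  rw [← pow_mul]
  congr 2

lemma gO_mul {x : ℂ} (h : ‖x‖ < 1) : gO x * gO (-x) = gO (x ^ 2) := by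
  have h' : ‖-x‖ < 1 := by rwa [norm_neg]
  unfold gO
  rw [← (gO_mult h).tprod_mul (gO_mult h')]
  refine tprod_congr fun n => ?_
  rw [Odd.neg_pow ⟨n, rfl⟩]
  ring

lemma gE_rel {x : ℂ} (h : ‖x‖ < 1) : gE (-x) * gE x * gE (x ^ 4) = gE (x ^ 2) ^ 3 := by
  have h' : ‖-x‖ < 1 := by rwa [norm_neg]
  have h2 := gE_split (pow_lt h (n := 2) (by norm_num))
  have e1 := gE_split h
  have e2 := gE_split h'
  rw [neg_sq] at e2
  rw [← pow_mul, show 2 * 2 = 4 by norm_num, ← gO_mul h] at h2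
  calc _ = (gO x * gO (-x) * gE (x ^ 4)) * gE (x ^ 2) ^ 2 := by rw [e1, e2]; ring
    _ = _ := by rw [← h2]; ring

lemma gU_rel {x : ℂ} (h : ‖x‖ < 1) : gU (-x) * gU x * gU (x ^ 4) = gU (x ^ 2) ^ 3 := by
  have h3 := gE_rel (pow_lt h (n := 3) (by norm_num))
  have h1 := gE_rel h
  unfold gU
  rw [← mul_pow, ← mul_pow, ← pow_mul, ← pow_mul, ← pow_mul, mul_comm 12 3, pow_mul _ 3 12]
  congr 1
  rw [div_mul_div_comm, div_mul_div_comm, div_pow, h1]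
  congr 1
  rw [← pow_mul, ← pow_mul] at h3
  rw [Odd.neg_pow (by decide)]
  exact h3

lemma gF_rel {x : ℂ} (h : ‖x‖ < 1) : gF (-x) * gF x * gF (x ^ 4) = - gF (x ^ 2) ^ 3 := by
  have := gU_rel h
  unfold gF
  rw [mul_pow, ← this]
  ring

lemma etaM_eq {τ : ℂ} (h : 0 < τ.im) : etaMG3A τ = etaG3A (2 * τ) / etaG3A τ := by
  unfold etaMG3A etaG3A
  have h2 : 0 < (2 * τ).im := by simpa using h
  have h3 := im_three h
  have h6 : 0 < (6 * τ).im := by simpa using h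
  have a := eta_ne h
  have b := eta_ne h2
  have c := eta_ne h3
  have d := eta_ne h6
  rw [show 3 * (2 * τ) = 6 * τ by ring]
  field_simp

lemma hG_two {τ : ℂ} (h : 0 < τ.im) :
    hG 2 τ = etaG3A (τ / 2) + etaG3A ((τ + 1) / 2) + etaG3A (2 * τ) := by
  rw [hG_eq]
  have : hD 2 = {(1, 2), (2, 1)} := by decide
  rw [this, Finset.sum_pair (by decide)]
  simp [Finset.sum_range_succ]

lemma phi_eq {τ : ℂ} (h : 0 < τ.im) : phi3A τ = 12 + 729 * etaG3A τ := by
  have hh : 0 < (τ / 2).im := by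
    have := Complex.div_natCast_im τ 2
    push_cast at this
    rw [this]; positivity
  have h2 : 0 < (2 * τ).im := by simpa using h
  have e2 := hG_two h
  have hT := Tc_spec 2 h
  rw [Finset.sum_Icc_succ_top (by omega)] at hT
  simp only [Finset.Icc_self, Finset.sum_singleton] at hT
  rw [Tc_diag 1 2 le_rfl (by omega), Cc_eq one_pos, Tc_lead (by omega), Bc12] at hT
  norm_num at hT
  have hx := gF_rel (norm_nome_lt hh)
  have n1 : nome (τ / 2) ^ 2 = nome τ := by
    rw [← nome_mul]; congr 1; push_cast; ring
  have n2 : nome (τ / 2) ^ 4 = nome (2 * τ) := by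
    rw [← nome_mul]; congr 1; push_cast; ring
  have n3 : - nome (τ / 2) = nome ((τ + 1) / 2) := by
    rw [add_div, nome_add]
    have : nome (1 / 2) = -1 := by
      unfold nome
      rw [show 2 * (π : ℂ) * Complex.I * (1 / 2) = π * Complex.I by ring, Complex.exp_pi_mul_I]
    rw [this]; ring
  rw [n1, n2, n3, ← etaG_eq, ← etaG_eq, ← etaG_eq, ← etaG_eq] at hx
  unfold phi3A
  rw [etaM_eq h, etaM_eq hh, show 2 * (τ / 2) = τ by ring]
  rw [e2] at hT
  have a := G_ne h
  have b := G_ne hh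
  have c := G_ne h2
  generalize etaG3A (τ / 2) = A at *
  generalize etaG3A (2 * τ) = B at *
  generalize etaG3A ((τ + 1) / 2) = C at *
  generalize etaG3A τ = D at *
  have hC : C = - D ^ 3 / (A * B) := by
    field_simp
    linear_combination hx
  have hC2 : D / A / (B / D) = - C / D := by
    rw [hC]; field_simp
  rw [hC2]
  field_simp
  linear_combination hT

lemma a_eq {a : ℕ → ℂ} (ha : ∀ τ : ℂ, 0 < τ.im →
      HasSum (fun n : ℕ => a n * Complex.exp (2 * Real.pi * Complex.I * τ) ^ n) (phi3A τ)) :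
    a 0 = 12 ∧ ∀ n, 0 < n → a n = 729 * Bc 1 n := by
  have : a = fun n => (if n = 0 then 12 else 0) + 729 * Bc 1 n := by
    refine puniq (f := fun x => 12 + 729 * gF x) ?_ ?_
    · intro x h0 h1
      obtain ⟨τ, hτ, rfl⟩ := exists_nome h0 h1
      have := ha τ hτ
      rw [phi_eq hτ, etaG_eq] at this
      exact this
    · intro x h0 h1
      have h2 := (Bc_hasSum 1 h1).mul_left 729
      rw [pow_one] at h2
      have h3 := (hasSum_ite_eq (0 : ℕ) (12 : ℂ)).add h2
      refine hs_congr h3 fun n => ?_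
      by_cases hn : n = 0
      · subst hn; simp
      · simp [hn]; ring
  rw [this]
  constructor
  · simp [Bc_lt]
  · intro n hn
    simp [hn.ne']

end C3A

namespace C3A
open Filter Topology

lemma pair_hasSum_r {j d : ℕ} (hj : 0 < j) (hd : 0 < d) {τ : ℂ} (h : 0 < τ.im) :
    HasSum (fun r : ℕ => (d : ℂ) * Bc 1 (d * r) * nome τ ^ (j * r))
      (∑ b ∈ Finset.range d, etaG3A ((j * τ + b) / d)) := by
  have h1 := pair_hasSum hj hd h
  have hi : Function.Injective (fun r : ℕ => j * r) := fun a b hab => Nat.eq_of_mul_eq_mul_left hj hab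
  rw [← hi.hasSum_iff] at h1
  · refine hs_congr h1 fun r => ?_
    simp only [Function.comp]
    rw [if_pos (dvd_mul_right j r), Nat.mul_div_cancel_left _ hj]
  · intro n hn
    rw [if_neg, zero_mul]
    rintro ⟨r, rfl⟩
    exact hn ⟨r, rfl⟩

noncomputable def KK : ℝ := Real.exp (2 * π)

lemma KK_pos : 0 < KK := Real.exp_pos _

lemma one_le_KK : 1 ≤ KK := Real.one_le_exp (by positivity)

lemma Bc_zero : Bc 1 0 = 0 := Bc_lt (by omega)

lemma Bc_dr (d r : ℕ) : ‖Bc 1 (d * r)‖ ≤ KK ^ d * KK ^ r := by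
  have hK := KK_pos
  rcases Nat.eq_zero_or_pos d with rfl | hd
  · rw [zero_mul, Bc_zero, norm_zero]; positivity
  rcases Nat.eq_zero_or_pos r with rfl | hr
  · rw [mul_zero, Bc_zero, norm_zero]; positivity
  have hd' : (0 : ℝ) < d := by exact_mod_cast hd
  have hr' : (0 : ℝ) < r := by exact_mod_cast hr
  have h1 := Bc_bound' (d * r) (y := 1 / ((d : ℝ) + r)) (by positivity)
  refine h1.trans ?_
  rw [← pow_add, KK, ← Real.exp_nat_mul]
  refine Real.exp_le_exp.mpr ?_
  rw [mul_comm]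
  refine mul_le_mul_of_nonneg_right ?_ (by positivity)
  push_cast
  have : 1 / (3 * (1 / ((d : ℝ) + r))) + d * r * (1 / ((d : ℝ) + r)) =
    (((d : ℝ) + r) ^ 2 / 3 + d * r) / (d + r) := by field_simp
  rw [this, div_le_iff₀ (by positivity)]
  nlinarith [sq_nonneg ((d : ℝ) - r), mul_pos hd' hr']

noncomputable def MM (p q : ℂ) (x : (ℕ × ℕ) × ℕ) : ℂ :=
  Bc 1 (x.1.1 * x.1.2) * (p ^ (x.1.1 * x.2) * q ^ (x.1.2 * x.2) / x.2)

lemma MM_bound {p q : ℂ} (hp0 : p ≠ 0) (hp : ‖p‖ ≤ 1) (hq : ‖q‖ ≤ 1) (d r j : ℕ) :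
    ‖MM p q ((d, r), j)‖ ≤ (1 / ‖p‖) * (((KK * ‖p‖) ^ d * (KK * ‖q‖) ^ r) * ‖p‖ ^ j) := by
  have hK := KK_pos
  have hP : 0 < ‖p‖ := norm_pos_iff.mpr hp0
  unfold MM
  simp only
  rcases Nat.eq_zero_or_pos d with rfl | hd
  · rw [zero_mul, Bc_zero, zero_mul, norm_zero]; positivity
  rcases Nat.eq_zero_or_pos j with rfl | hj
  · simp only [Nat.cast_zero, div_zero, mul_zero, norm_zero]; positivity
  rw [norm_mul, norm_div, norm_mul, norm_pow, norm_pow, Complex.norm_natCast]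
  have h1 : ‖p‖ ^ (d * j) ≤ 1 / ‖p‖ * (‖p‖ ^ d * ‖p‖ ^ j) := by
    rw [one_div, inv_mul_eq_div, le_div_iff₀ hP, ← pow_succ, ← pow_add]
    exact pow_le_pow_of_le_one hP.le hp (by nlinarith)
  have h2 : ‖q‖ ^ (r * j) ≤ ‖q‖ ^ r := pow_le_pow_of_le_one (norm_nonneg _) hq (by nlinarith)
  have hj1 : (1 : ℝ) ≤ j := by exact_mod_cast hj
  have h3 : ‖p‖ ^ (d * j) * ‖q‖ ^ (r * j) / j ≤ (1 / ‖p‖ * (‖p‖ ^ d * ‖p‖ ^ j)) * ‖q‖ ^ r := by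
    refine (div_le_self (by positivity) hj1).trans ?_
    exact mul_le_mul h1 h2 (by positivity) (by positivity)
  refine (mul_le_mul (Bc_dr d r) h3 (by positivity) (by positivity)).trans_eq ?_
  rw [mul_pow, mul_pow]
  ring

lemma MM_summable {p q : ℂ} (hp0 : p ≠ 0) (hp : KK * ‖p‖ < 1) (hq : KK * ‖q‖ < 1) :
    Summable (MM p q) := by
  have hK := KK_pos
  have hK1 := one_le_KK
  have hp1 : ‖p‖ < 1 := lt_of_le_of_lt (le_mul_of_one_le_left (norm_nonneg _) hK1) hp
  have hq1 : ‖q‖ < 1 := lt_of_le_of_lt (le_mul_of_one_le_left (norm_nonneg _) hK1) hq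
  have s1 := summable_geometric_of_lt_one (by positivity) hp
  have s2 := summable_geometric_of_lt_one (by positivity) hq
  have s3 := summable_geometric_of_lt_one (by positivity) hp1
  have s4 := s1.mul_of_nonneg s2 (fun n => by positivity) (fun n => by positivity)
  have s5 := s4.mul_of_nonneg s3 (fun n => by positivity) (fun n => by positivity)
  refine Summable.of_norm_bounded (s5.mul_left (1 / ‖p‖)) ?_
  rintro ⟨⟨d, r⟩, j⟩
  exact MM_bound hp0 hp1.le hq1.le d r j

noncomputable def MT (p q : ℂ) (x : (ℕ × ℕ) × ℕ) : ℂ := if 3 ∣ x.2 then 0 else MM p q x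

lemma MT_summable {p q : ℂ} (hp0 : p ≠ 0) (hp : KK * ‖p‖ < 1) (hq : KK * ‖q‖ < 1) :
    Summable (MT p q) := by
  refine Summable.of_norm_bounded (MM_summable hp0 hp hq).norm fun x => ?_
  unfold MT
  split_ifs
  · rw [norm_zero]; positivity
  · exact le_rfl

def eqv : (ℕ × ℕ) × ℕ ≃ (ℕ × ℕ) × ℕ where
  toFun x := ((x.1.2, x.2), x.1.1)
  invFun x := ((x.2, x.1.1), x.1.2)
  left_inv _ := rfl
  right_inv _ := rfl

noncomputable def YY (p τ : ℂ) (x : ℕ × ℕ) : ℂ := if 3 ∣ x.1 then 0 else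
  p ^ (x.1 * x.2) / (x.1 * x.2 : ℕ) * ∑ b ∈ Finset.range x.2, etaG3A ((x.1 * τ + b) / x.2)

lemma MT_step {p τ : ℂ} (h : 0 < τ.im) (s : Summable (MT p (nome τ))) :
    HasSum (fun N : ℕ => p ^ N / N * hG N τ) (∑' x, MT p (nome τ) x) := by
  have h1 := s.hasSum
  rw [← eqv.hasSum_iff] at h1
  have key : ∀ x : ℕ × ℕ, HasSum (fun r => (MT p (nome τ) ∘ eqv) (x, r)) (YY p τ x) := by
    rintro ⟨j, d⟩
    have e : ∀ r, (MT p (nome τ) ∘ eqv) ((j, d), r) = MT p (nome τ) ((d, r), j) := fun r => rfl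
    simp only [e]
    by_cases hj : 3 ∣ j
    · have e1 : YY p τ (j, d) = 0 := if_pos hj
      have e2 : ∀ r, MT p (nome τ) ((d, r), j) = 0 := fun r => if_pos hj
      rw [e1]
      simp only [e2]
      exact hasSum_zero
    have e1 : YY p τ (j, d) = p ^ (j * d) / (j * d : ℕ) *
      ∑ b ∈ Finset.range d, etaG3A ((j * τ + b) / d) := if_neg hj
    have e2 : ∀ r, MT p (nome τ) ((d, r), j) = Bc 1 (d * r) * (p ^ (d * j) * nome τ ^ (r * j) / j) :=
      fun r => if_neg hj
    rw [e1]
    simp only [e2]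
    rcases Nat.eq_zero_or_pos d with rfl | hd
    · simp only [zero_mul, Bc_zero, mul_zero, Nat.cast_zero, div_zero]
      exact hasSum_zero
    have hj0 : 0 < j := Nat.pos_of_ne_zero (by rintro rfl; exact hj (dvd_zero 3))
    have hjc : (j : ℂ) ≠ 0 := by exact_mod_cast hj0.ne'
    have hdc : (d : ℂ) ≠ 0 := by exact_mod_cast hd.ne'
    refine hs_congr ((pair_hasSum_r hj0 hd h).mul_left _) fun r => ?_
    push_cast
    rw [mul_comm d j, mul_comm r j]
    field_simp
  have h2 : HasSum (YY p τ) (∑' x, MT p (nome τ) x) := HasSum.prod_fiberwise h1 key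
  have h3 := h2.tsum_fiberwise (fun x : ℕ × ℕ => x.1 * x.2)
  refine hs_congr h3 fun N => ?_
  rcases Nat.eq_zero_or_pos N with rfl | hN
  · rw [Nat.cast_zero, div_zero, zero_mul]
    refine (tsum_congr (fun b => ?_)).trans tsum_zero
    have hb : b.1.1 * b.1.2 = 0 := b.2
    unfold YY
    rw [hb, Nat.cast_zero, div_zero, zero_mul, ite_self]
  · have hs : (fun x : ℕ × ℕ => x.1 * x.2) ⁻¹' {N} = ↑(Nat.divisorsAntidiagonal N) := by
      ext x
      simp [Nat.mem_divisorsAntidiagonal]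
      omega
    rw [hs, Finset.tsum_subtype' (Nat.divisorsAntidiagonal N) (YY p τ), hG_eq, Finset.mul_sum, hD, Finset.sum_filter]
    refine Finset.sum_congr rfl fun x hx => ?_
    rw [Nat.mem_divisorsAntidiagonal] at hx
    unfold YY
    rw [hx.1]
    split_ifs <;> simp_all

lemma Cc_zero : Cc 0 = 0 := by simp [Cc]

lemma Cc_eq' (k : ℕ) : Cc k = (1 / 729) * (729 ^ k / k) := by
  rcases Nat.eq_zero_or_pos k with rfl | hk
  · simp [Cc_zero]
  · rw [Cc_eq hk]
    obtain ⟨m, rfl⟩ : ∃ m, k = m + 1 := ⟨k - 1, by omega⟩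
    rw [Nat.add_sub_cancel, pow_succ]
    ring

lemma Cc_norm (k : ℕ) : ‖Cc k‖ ≤ 729 ^ k := by
  rcases Nat.eq_zero_or_pos k with rfl | hk
  · simp [Cc_zero]
  · have h0 : ‖(729 ^ k / k : ℂ)‖ = ‖(729 : ℂ)‖ ^ k / k := by
      rw [norm_div, norm_pow, Complex.norm_natCast]
    rw [Cc_eq', norm_mul, h0]
    have hk1 : (1 : ℝ) ≤ k := by exact_mod_cast hk
    have h1 : ‖(729 : ℂ)‖ = 729 := by simp
    have h2 : ‖(1 / 729 : ℂ)‖ ≤ 1 := by norm_num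
    rw [h1]
    have h3 : (729 : ℝ) ^ k / k ≤ 729 ^ k := div_le_self (by positivity) hk1
    calc _ ≤ 1 * (729 : ℝ) ^ k := mul_le_mul h2 h3 (by positivity) (by positivity)
      _ = _ := one_mul _

noncomputable def ZZ (p t : ℂ) (x : ℕ × ℕ) : ℂ := Cc x.1 * t ^ x.1 * (Bc x.1 x.2 * p ^ x.2)

lemma ZZ_mk (p t : ℂ) (k N : ℕ) : ZZ p t (k, N) = Cc k * t ^ k * (Bc k N * p ^ N) := rfl

lemma ZZ_bd {p t : ℂ} {g : ℝ} (k N : ℕ) (hg : ‖Bc k N‖ ≤ g ^ k / (1 / 2) ^ N) :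
    ‖ZZ p t (k, N)‖ ≤ (729 * ‖t‖ * g) ^ k * (2 * ‖p‖) ^ N := by
  rw [ZZ_mk, norm_mul, norm_mul, norm_mul, norm_pow, norm_pow]
  have b2 : ‖Bc k N‖ * ‖p‖ ^ N ≤ (g ^ k / (1 / 2) ^ N) * ‖p‖ ^ N :=
    mul_le_mul_of_nonneg_right hg (by positivity)
  have b3 : ‖Cc k‖ * ‖t‖ ^ k ≤ 729 ^ k * ‖t‖ ^ k :=
    mul_le_mul_of_nonneg_right (Cc_norm k) (by positivity)
  refine (mul_le_mul b3 b2 (by positivity) (by positivity)).trans_eq ?_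
  rw [mul_pow, mul_pow, mul_pow, one_div, inv_pow, div_inv_eq_mul]
  ring

lemma ZZ_summable {p t : ℂ} {g : ℝ} (h0 : 0 ≤ g) (hg : ∀ k N, ‖Bc k N‖ ≤ g ^ k / (1 / 2) ^ N)
    (hp : ‖p‖ < 1 / 2) (h1 : 729 * ‖t‖ * g < 1) : Summable (ZZ p t) := by
  have s1 := summable_geometric_of_lt_one (by positivity) h1
  have s2 := summable_geometric_of_lt_one (r := 2 * ‖p‖) (by positivity) (by linarith)
  have s4 := s1.mul_of_nonneg s2 (fun n => by positivity) (fun n => by positivity)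
  refine Summable.of_norm_bounded s4 ?_
  rintro ⟨k, N⟩
  exact ZZ_bd k N (hg k N)

lemma ZZ_row {p t : ℂ} (k : ℕ) (hp : ‖p‖ < 1) :
    HasSum (fun N => ZZ p t (k, N)) (Cc k * t ^ k * gF p ^ k) := by
  have h := (Bc_hasSum k hp).mul_left (Cc k * t ^ k)
  exact hs_congr h fun N => rfl

lemma ZZ_col {p τ : ℂ} (h : 0 < τ.im) (N : ℕ) :
    HasSum (fun k => ZZ p (etaG3A τ) (k, N)) (p ^ N / N * hG N τ) := by
  have e : p ^ N / N * hG N τ = ∑ k ∈ Finset.Icc 1 N, ZZ p (etaG3A τ) (k, N) := by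
    rw [Tc_spec N h, Finset.mul_sum]
    refine Finset.sum_congr rfl fun k hk => ?_
    rw [Finset.mem_Icc] at hk
    have : (N : ℂ) ≠ 0 := by exact_mod_cast (by omega : N ≠ 0)
    rw [Tc_diag k N hk.1 hk.2, ZZ_mk]
    field_simp
  rw [e]
  refine hasSum_sum_of_ne_finset_zero fun k hk => ?_
  rw [ZZ_mk]
  rcases Nat.eq_zero_or_pos k with rfl | hk0
  · rw [Cc_zero]; ring
  · rw [Bc_lt]
    · ring
    · rw [Finset.mem_Icc] at hk
      omega

lemma log_step {p τ : ℂ} (h : 0 < τ.im) (hp : ‖p‖ < 1 / 2)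
    (h1 : 729 * ‖etaG3A τ‖ * ‖gF (1 / 2 : ℝ)‖ < 1) (h2 : ‖729 * gF p * etaG3A τ‖ < 1) :
    HasSum (fun N : ℕ => p ^ N / N * hG N τ)
      (-(1 / 729) * Complex.log (1 - 729 * gF p * etaG3A τ)) := by
  have hZ : Summable (ZZ p (etaG3A τ)) := ZZ_summable (norm_nonneg _)
    (fun k N => Bc_bound k N (by norm_num) (by norm_num)) hp h1
  have hp1 : ‖p‖ < 1 := hp.trans (by norm_num)
  have c1 : HasSum (fun k : ℕ => Cc k * etaG3A τ ^ k * gF p ^ k) (∑' x, ZZ p (etaG3A τ) x) :=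
    HasSum.prod_fiberwise hZ.hasSum fun k => ZZ_row k hp1
  have c2 : HasSum (fun k : ℕ => Cc k * etaG3A τ ^ k * gF p ^ k)
      (-(1 / 729) * Complex.log (1 - 729 * gF p * etaG3A τ)) := by
    have := (Complex.hasSum_taylorSeries_neg_log h2).mul_left (1 / 729)
    rw [neg_mul, ← mul_neg]
    refine hs_congr this fun k => ?_
    rw [Cc_eq', mul_pow, mul_pow]
    ring
  rw [← c1.unique c2]
  have c3 := hZ.hasSum
  rw [← (Equiv.prodComm ℕ ℕ).hasSum_iff] at c3
  exact HasSum.prod_fiberwise c3 fun N => ZZ_col h N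

end C3A

namespace C3A
open Filter Topology

lemma fin_comb (f : Fin 3 → ℕ × ℕ → ℂ) (s : Fin 3 → ℂ) (h : ∀ k, HasProd (f k) (s k)) :
    HasProd (fun z : ℕ × Fin 3 × ℕ => f z.2.1 (z.1, z.2.2)) (∏ k, s k) := by
  have h1 : ∀ k : Fin 3, HasProd (fun z : ℕ × Fin 3 × ℕ =>
      if z.2.1 = k then f k (z.1, z.2.2) else 1) (s k) := by
    intro k
    have hi : Function.Injective (fun x : ℕ × ℕ => ((x.1, k, x.2) : ℕ × Fin 3 × ℕ)) := by
      rintro ⟨a, b⟩ ⟨c, d⟩ h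
      simp at h
      simp [h]
    rw [← hi.hasProd_iff]
    · convert h k using 1
      ext x
      simp [Function.comp]
    · rintro ⟨a, b, c⟩ hx
      refine if_neg ?_
      rintro rfl
      exact hx ⟨(a, c), rfl⟩
  have h2 := hasProd_prod (s := Finset.univ) (fun k _ => h1 k)
  convert h2 using 1
  ext z
  rw [Finset.prod_ite_eq]
  simp

lemma r_zero (c : ℕ → ℂ) (L : ℂ) (h : HasProd c L) :
    HasProd (fun x : ℕ × ℕ => if x.2 = 0 then c x.1 else 1) L := by
  have hi : Function.Injective (fun d : ℕ => ((d, 0) : ℕ × ℕ)) := by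
    intro a b h
    simpa using h
  rw [← hi.hasProd_iff]
  · have e : ((fun x : ℕ × ℕ => if x.2 = 0 then c x.1 else 1) ∘ fun d => (d, 0)) = c := by
      funext d
      simp
    rw [e]
    exact h
  · rintro ⟨a, b⟩ hx
    refine if_neg ?_
    rintro rfl
    exact hx ⟨a, rfl⟩

noncomputable def FF (p q e ζ : ℂ) (x : (ℕ × ℕ) × ℕ) : ℂ := -(e * ζ ^ x.2) * MM p q x

lemma FF_summable {p q e ζ : ℂ} (hζ : ‖ζ‖ = 1) (s : Summable (MM p q)) : Summable (FF p q e ζ) := by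
  refine Summable.of_norm_bounded (s.norm.mul_left ‖e‖) fun x => ?_
  rw [FF, norm_mul, norm_neg, norm_mul, norm_pow, hζ, one_pow, mul_one]

lemma FF_row {p q e ζ : ℂ} (hζ : ‖ζ‖ = 1) (hp : ‖p‖ < 1) (hq : ‖q‖ < 1) (d r : ℕ) :
    HasSum (fun j => FF p q e ζ ((d, r), j))
      (e * Bc 1 (d * r) * Complex.log (1 - ζ * p ^ d * q ^ r)) := by
  rcases Nat.eq_zero_or_pos d with rfl | hd
  · have : ∀ j, FF p q e ζ ((0, r), j) = 0 := fun j => by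
      simp [FF, MM, Bc_zero]
    simp only [this, zero_mul, Bc_zero, mul_zero]
    exact hasSum_zero
  have hn : ‖ζ * p ^ d * q ^ r‖ < 1 := by
    rw [norm_mul, norm_mul, hζ, one_mul, norm_pow, norm_pow]
    have h1 : ‖p‖ ^ d < 1 := pow_lt_one₀ (norm_nonneg _) hp hd.ne'
    have h2 : ‖q‖ ^ r ≤ 1 := pow_le_one₀ (norm_nonneg _) hq.le
    exact mul_lt_one_of_nonneg_of_lt_one_left (by positivity) h1 h2
  have h := (Complex.hasSum_taylorSeries_neg_log hn).mul_left (-(e * Bc 1 (d * r)))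
  rw [neg_mul_neg] at h
  refine hs_congr h fun j => ?_
  simp only [FF, MM]
  rw [mul_pow, mul_pow, ← pow_mul, ← pow_mul]
  ring

lemma B_hasProd {p q e ζ : ℂ} (hζ : ‖ζ‖ = 1) (hp : ‖p‖ < 1) (hq : ‖q‖ < 1)
    (s : Summable (MM p q)) :
    HasProd (fun x : ℕ × ℕ => Complex.exp (e * Bc 1 ((x.1 + 1) * x.2) *
      Complex.log (1 - ζ * p ^ (x.1 + 1) * q ^ x.2)))
      (Complex.exp (∑' x, FF p q e ζ x)) := by
  have h1 : HasSum (fun x : ℕ × ℕ => e * Bc 1 (x.1 * x.2) *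
      Complex.log (1 - ζ * p ^ x.1 * q ^ x.2)) (∑' x, FF p q e ζ x) :=
    HasSum.prod_fiberwise (FF_summable hζ s).hasSum fun x => FF_row hζ hp hq x.1 x.2
  have hi : Function.Injective (fun x : ℕ × ℕ => ((x.1 + 1, x.2) : ℕ × ℕ)) := by
    rintro ⟨a, b⟩ ⟨c, d⟩ h
    simp at h
    simp [h]
  rw [← hi.hasSum_iff] at h1
  · exact h1.cexp
  · rintro ⟨a, b⟩ hx
    rcases Nat.eq_zero_or_pos a with rfl | ha
    · simp [Bc_zero]
    · exact absurd ⟨(a - 1, b), by simp; omega⟩ hx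

noncomputable def LL (ζ p : ℂ) : ℂ := ∏' n : ℕ, (1 - ζ * p ^ (n + 1))

lemma LL_sum {ζ p : ℂ} (hp : ‖p‖ < 1) : Summable fun n : ℕ => ‖-(ζ * p ^ (n + 1))‖ := by
  have s := (summable_geometric_of_lt_one (norm_nonneg p) hp).mul_left (‖ζ‖ * ‖p‖)
  refine s.congr fun n => ?_
  rw [norm_neg, norm_mul, norm_pow, pow_succ]
  ring

lemma LL_hasProd {ζ p : ℂ} (hp : ‖p‖ < 1) : HasProd (fun n : ℕ => 1 - ζ * p ^ (n + 1)) (LL ζ p) := by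
  have := (multipliable_one_add_of_summable (LL_sum (ζ := ζ) hp)).hasProd
  simp only [← sub_eq_add_neg] at this
  exact this

lemma LL_fac {ζ p : ℂ} (hζ : ‖ζ‖ = 1) (hp : ‖p‖ < 1) (n : ℕ) : 1 - ζ * p ^ (n + 1) ≠ 0 := by
  intro h
  have h1 : ‖ζ * p ^ (n + 1)‖ < 1 := by
    rw [norm_mul, hζ, one_mul, norm_pow]
    exact pow_lt_one₀ (norm_nonneg _) hp (by omega)
  rw [← sub_eq_zero.mp h, norm_one] at h1
  exact lt_irrefl _ h1

lemma LL_ne {ζ p : ℂ} (hζ : ‖ζ‖ = 1) (hp : ‖p‖ < 1) : LL ζ p ≠ 0 := by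
  have := tprod_one_add_ne_zero_of_summable (f := fun n : ℕ => -(ζ * p ^ (n + 1)))
    (fun n => by rw [← sub_eq_add_neg]; exact LL_fac hζ hp n) (LL_sum hp)
  simp only [← sub_eq_add_neg] at this
  exact this

lemma LL_inv {ζ p : ℂ} (hζ : ‖ζ‖ = 1) (hp : ‖p‖ < 1) :
    HasProd (fun n : ℕ => Complex.exp (-12 * Complex.log (1 - ζ * p ^ (n + 1)))) ((LL ζ p ^ 12)⁻¹) := by
  have h := ((LL_hasProd (ζ := ζ) hp).pow 12).inv₀ (pow_ne_zero _ (LL_ne hζ hp))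
  have e : (fun n : ℕ => Complex.exp (-12 * Complex.log (1 - ζ * p ^ (n + 1)))) =
      fun n : ℕ => ((1 - ζ * p ^ (n + 1)) ^ 12)⁻¹ := by
    funext n
    rw [neg_mul, Complex.exp_neg, show (12 : ℂ) = ((12 : ℕ) : ℂ) by norm_num, Complex.exp_nat_mul,
      Complex.exp_log (LL_fac hζ hp n)]
  rw [e]
  exact h

lemma LL_mul {ζ p : ℂ} (hz : 1 + ζ + ζ ^ 2 = 0) (hp : ‖p‖ < 1) :
    gE p * (LL ζ p * LL (ζ ^ 2) p) = gE (p ^ 3) := by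
  have h := (gE_mult hp).hasProd.mul ((LL_hasProd (ζ := ζ) hp).mul (LL_hasProd (ζ := ζ ^ 2) hp))
  have h3 := (gE_mult (pow_lt hp (n := 3) (by norm_num))).hasProd
  refine h.unique ?_
  have : (fun n : ℕ => (1 - p ^ (n + 1)) * ((1 - ζ * p ^ (n + 1)) * (1 - ζ ^ 2 * p ^ (n + 1)))) =
      fun n : ℕ => 1 - (p ^ 3) ^ (n + 1) := by
    ext n
    rw [← pow_mul, mul_comm 3, pow_mul]
    generalize p ^ (n + 1) = x
    have h31 : ζ ^ 3 = 1 := by linear_combination (ζ - 1) * hz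
    linear_combination (-x + ζ * x ^ 2) * hz - x ^ 3 * h31
  rw [this]
  exact h3

lemma root_sums {ζ : ℂ} (hz : 1 + ζ + ζ ^ 2 = 0) (j : ℕ) :
    2 - ζ ^ j - (ζ ^ 2) ^ j = if 3 ∣ j then 0 else 3 := by
  have h31 : ζ ^ 3 = 1 := by linear_combination (ζ - 1) * hz
  have hm : j = 3 * (j / 3) + j % 3 := (Nat.div_add_mod j 3).symm
  have h1 : ζ ^ j = ζ ^ (j % 3) := by
    conv_lhs => rw [hm, pow_add, pow_mul, h31, one_pow, one_mul]
  rw [← pow_mul, mul_comm, pow_mul, h1]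
  simp only [Nat.dvd_iff_mod_eq_zero]
  have : j % 3 < 3 := Nat.mod_lt _ (by norm_num)
  interval_cases h : j % 3
  · norm_num
  · simp; linear_combination -hz
  · simp; linear_combination -hz - ζ * h31

lemma FF_total {p q ζ : ℂ} (hζ : ‖ζ‖ = 1) (hz : 1 + ζ + ζ ^ 2 = 0) (s : Summable (MM p q)) :
    (∑' x, FF p q 486 1 x) + (∑' x, FF p q (-243) ζ x) + (∑' x, FF p q (-243) (ζ ^ 2) x) =
      -729 * ∑' x, MT p q x := by
  have hζ2 : ‖ζ ^ 2‖ = 1 := by rw [norm_pow, hζ, one_pow]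
  have s0 := FF_summable (e := 486) (ζ := 1) norm_one s
  have s1 := FF_summable (e := -243) hζ s
  have s2 := FF_summable (e := -243) hζ2 s
  rw [← s0.tsum_add s1, ← (s0.add s1).tsum_add s2, ← tsum_mul_left]
  refine tsum_congr fun x => ?_
  have h := root_sums hz x.2
  simp only [FF, MT, one_pow]
  split_ifs at h ⊢
  · linear_combination (-243) * MM p q x * h
  · linear_combination (-243) * MM p q x * h

lemma fin_exp (k : ℕ) : Complex.exp (2 * Real.pi * Complex.I * (k : ℂ) / 3) =
    Complex.exp (2 * Real.pi * Complex.I / 3) ^ k := by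
  rw [← Complex.exp_nat_mul]
  congr 1
  ring

lemma ev_choose : ∃ Y > (1 : ℝ), ∀ t : ℂ, Y < t.im →
    729 * ‖etaG3A t‖ * ‖gF (1 / 2 : ℝ)‖ < 1 ∧ 729 * ‖etaG3A t‖ < 1 := by
  have h0 : Tendsto (fun t => ‖etaG3A t‖) iInf (𝓝 0) := by
    simpa using G_tendsto.norm
  have e : ∀ᶠ t in iInf, ‖etaG3A t‖ < 1 / (729 * (1 + ‖gF (1 / 2 : ℝ)‖)) :=
    h0.eventually_lt_const (by positivity)
  rw [iInf, eventually_comap] at e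
  obtain ⟨Y, hY⟩ := eventually_atTop.mp e
  refine ⟨max Y 2, lt_max_of_lt_right (by norm_num), fun t ht => ?_⟩
  have h1 := hY t.im ((le_max_left Y 2).trans ht.le) t rfl
  have h2 := norm_nonneg (gF (1 / 2 : ℝ))
  have h3 := norm_nonneg (etaG3A t)
  generalize ‖gF (1 / 2 : ℝ)‖ = g at *
  generalize ‖etaG3A t‖ = u at *
  rw [lt_div_iff₀ (by positivity)] at h1
  constructor <;> nlinarith [mul_nonneg h2 h3]

lemma KK_nome {t : ℂ} (h : 1 < t.im) : KK * ‖nome t‖ < 1 ∧ ‖nome t‖ < 1 / 2 := by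
  rw [KK, norm_nome]
  constructor
  · rw [← Real.exp_add, Real.exp_lt_one_iff]
    nlinarith [Real.pi_pos]
  · have h1 : Real.exp (-(2 * π * t.im)) ≤ Real.exp (-1) := Real.exp_le_exp.mpr (by
      nlinarith [Real.pi_gt_three])
    have h2 : Real.exp (-1) < 1 / 2 := by
      have := Real.exp_one_gt_d9
      rw [Real.exp_neg, inv_eq_one_div]
      exact one_div_lt_one_div_of_lt (by norm_num) (by linarith)
    exact h1.trans_lt h2

end C3A

namespace C3A
open Filter Topology

lemma ehat_zero {a : ℕ → ℂ} (a0 : a 0 = 12) (k : Fin 3) :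
    ehat3A a 0 k = if k = 0 then 0 else -12 := by
  unfold ehat3A
  rw [a0, if_pos rfl]
  split_ifs <;> norm_num

lemma ehat_pos {a : ℕ → ℂ} (an : ∀ n, 0 < n → a n = 729 * Bc 1 n) {n : ℕ} (hn : 0 < n) (k : Fin 3) :
    ehat3A a n k = (if k = 0 then 486 else -243) * Bc 1 n := by
  unfold ehat3A
  rw [an n hn, if_neg hn.ne']
  split_ifs <;> ring

lemma final_eq {σ τ : ℂ} (hσ : 0 < σ.im) (hτ : 0 < τ.im) :
    nome σ * (eta σ ^ 12 / eta (3 * σ) ^ 12 + 12 - phi3A τ) =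
      (1 / gU (nome σ)) * (1 - 729 * gF (nome σ) * etaG3A τ) := by
  have h1 : eta σ ^ 12 / eta (3 * σ) ^ 12 = 1 / etaG3A σ := by
    rw [etaG3A, one_div_div]
  have hU := gU_ne (norm_nome_lt hσ)
  have hp := nome_ne σ
  rw [h1, phi_eq hτ, etaG_eq σ, gF]
  field_simp
  ring

lemma main_prod {a : ℕ → ℂ} (a0 : a 0 = 12) (an : ∀ n, 0 < n → a n = 729 * Bc 1 n)
    {σ τ : ℂ} (hσ : 1 < σ.im) (hτ : 1 < τ.im) (hs : 729 * ‖etaG3A σ‖ < 1)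
    (ht : 729 * ‖etaG3A τ‖ * ‖gF (1 / 2 : ℝ)‖ < 1) (ht2 : 729 * ‖etaG3A τ‖ < 1) :
    HasProd (fun z : ℕ × Fin 3 × ℕ =>
        Complex.exp (ehat3A a (z.2.2 * (z.1 + 1)) z.2.1 *
          Complex.log (1 - Complex.exp (2 * Real.pi * Complex.I * ((z.2.1 : ℕ) : ℂ) / 3) *
            nome σ ^ (z.1 + 1) * nome τ ^ z.2.2)))
        (nome σ * (eta σ ^ 12 / eta (3 * σ) ^ 12 + 12 - phi3A τ)) := by
  have hτ0 : 0 < τ.im := by linarith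
  have hσ0 : 0 < σ.im := by linarith
  rw [final_eq hσ0 hτ0]
  have hp0 := nome_ne σ
  obtain ⟨hpK, hp2⟩ := KK_nome hσ
  obtain ⟨hqK, hq2⟩ := KK_nome hτ
  have hp1 := norm_nome_lt hσ0
  have hq1 := norm_nome_lt hτ0
  rw [etaG_eq σ] at hs
  have hw : ‖729 * gF (nome σ) * etaG3A τ‖ < 1 := by
    rw [norm_mul, norm_mul]
    have h1 : ‖(729 : ℂ)‖ = 729 := by simp
    rw [h1]
    have h3 := norm_nonneg (etaG3A τ)
    have h4 := norm_nonneg (gF (nome σ))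
    have h5 : ‖etaG3A τ‖ < 1 := by linarith
    exact mul_lt_one_of_nonneg_of_lt_one_left (by positivity) hs h5.le
  have sM := MM_summable hp0 hpK hqK
  have hX := (MT_step hτ0 (MT_summable hp0 hpK hqK)).unique (log_step hτ0 hp2 ht hw)
  have hζr := Complex.isPrimitiveRoot_exp 3 (by norm_num)
  push_cast at hζr
  simp only [fin_exp]
  generalize Complex.exp (2 * Real.pi * Complex.I / 3) = ζ at hζr ⊢
  have hζ : ‖ζ‖ = 1 := hζr.norm'_eq_one (by norm_num)
  have hz : 1 + ζ + ζ ^ 2 = 0 := by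
    have := hζr.geom_sum_eq_zero (by norm_num)
    simpa [Finset.sum_range_succ] using this
  have hFF := FF_total hζ hz sM
  have hζk : ∀ k : Fin 3, ‖ζ ^ (k : ℕ)‖ = 1 := fun k => by rw [norm_pow, hζ, one_pow]
  let l : Fin 3 → ℂ := fun k => if k = 0 then 1 else (LL (ζ ^ (k : ℕ)) (nome σ) ^ 12)⁻¹
  let e : Fin 3 → ℂ := fun k => if k = 0 then 486 else -243
  have hA : ∀ k : Fin 3, HasProd (fun n : ℕ => Complex.exp (ehat3A a 0 k *
      Complex.log (1 - ζ ^ (k : ℕ) * nome σ ^ (n + 1)))) (l k) := by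
    intro k
    rw [ehat_zero a0]
    by_cases hk : k = 0
    · simp only [l, if_pos hk, zero_mul, Complex.exp_zero]
      exact hasProd_one
    · simp only [l, if_neg hk]
      exact LL_inv (hζk k) hp1
  have hB := fun k : Fin 3 => (r_zero _ _ (hA k)).mul
    (B_hasProd (e := e k) (hζk k) hp1 hq1 sM)
  have hC := fin_comb _ _ hB
  have hv : (∏ k : Fin 3, l k * Complex.exp (∑' x, FF (nome σ) (nome τ) (e k) (ζ ^ (k : ℕ)) x)) =
      (1 / gU (nome σ)) * (1 - 729 * gF (nome σ) * etaG3A τ) := by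
    rw [Fin.prod_univ_three]
    have e0 : l 0 = 1 := if_pos rfl
    have e1 : l 1 = (LL ζ (nome σ) ^ 12)⁻¹ := by simp [l]
    have e2 : l 2 = (LL (ζ ^ 2) (nome σ) ^ 12)⁻¹ := by simp [l]
    have f0 : e 0 = 486 := if_pos rfl
    have f1 : e 1 = -243 := by simp [e]
    have f2 : e 2 = -243 := by simp [e]
    have g0 : ζ ^ ((0 : Fin 3) : ℕ) = 1 := by simp
    have g1 : ζ ^ ((1 : Fin 3) : ℕ) = ζ := by simp
    have g2 : ζ ^ ((2 : Fin 3) : ℕ) = ζ ^ 2 := by simp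
    rw [e0, e1, e2, f0, f1, f2, g0, g1, g2]
    have hexp : Complex.exp (∑' x, FF (nome σ) (nome τ) 486 1 x) *
        Complex.exp (∑' x, FF (nome σ) (nome τ) (-243) ζ x) *
        Complex.exp (∑' x, FF (nome σ) (nome τ) (-243) (ζ ^ 2) x) =
        1 - 729 * gF (nome σ) * etaG3A τ := by
      rw [← Complex.exp_add, ← Complex.exp_add, hFF, hX]
      have hne : 1 - 729 * gF (nome σ) * etaG3A τ ≠ 0 := by
        intro h0
        rw [← sub_eq_zero.mp h0, norm_one] at hw
        exact lt_irrefl _ hw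
      conv_rhs => rw [← Complex.exp_log hne]
      congr 1
      ring
    have hL := LL_mul hz hp1
    have hU : 1 / gU (nome σ) = (LL ζ (nome σ) ^ 12)⁻¹ * (LL (ζ ^ 2) (nome σ) ^ 12)⁻¹ := by
      have hE := gE_ne hp1
      rw [gU, ← hL, mul_div_cancel_left₀ _ hE, mul_pow, one_div, mul_inv]
    rw [hU, ← hexp]
    ring
  rw [hv] at hC
  convert hC using 2 with z
  obtain ⟨d, k, r⟩ := z
  simp only
  rcases Nat.eq_zero_or_pos r with rfl | hr
  · simp [Bc_zero]
  · rw [if_neg hr.ne', one_mul, ehat_pos an (by positivity), mul_comm r]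

end C3A

/-- the `g`-twisted superdenominator identity for the class 3A of Co₀.
    With `a(n)` the Fourier coefficients of `φ`, there is `Y > 0` such that for
    `Im σ, Im τ > Y` the product over `d ≥ 1`, `k ∈ {0,1,2}`, `r ≥ 0` of
    `(1 − e^{2πik/3} p^d q^r)^{ê(rd,k)}` (with `w^β := exp(β·Log w)`) converges
    (absolutely, i.e. unconditionally) to `p · (η(σ)^{12}/η(3σ)^{12} + 12 − φ(τ))`. -/
theorem statement12 (a : ℕ → ℂ)
    (ha : ∀ τ : ℂ, 0 < τ.im →
      HasSum (fun n : ℕ => a n * Complex.exp (2 * Real.pi * Complex.I * τ) ^ n) (phi3A τ)) :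
    ∃ Y > (0 : ℝ), ∀ σ τ : ℂ, Y < σ.im → Y < τ.im →
      HasProd (fun z : ℕ × Fin 3 × ℕ =>
        Complex.exp (ehat3A a (z.2.2 * (z.1 + 1)) z.2.1 *
          Complex.log (1 - Complex.exp (2 * Real.pi * Complex.I * ((z.2.1 : ℕ) : ℂ) / 3) *
            Complex.exp (2 * Real.pi * Complex.I * σ) ^ (z.1 + 1) *
            Complex.exp (2 * Real.pi * Complex.I * τ) ^ z.2.2)))
        (Complex.exp (2 * Real.pi * Complex.I * σ) *
          (eta σ ^ 12 / eta (3 * σ) ^ 12 + 12 - phi3A τ)) := by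
  obtain ⟨a0, an⟩ := C3A.a_eq ha
  obtain ⟨Y, hY1, hY⟩ := C3A.ev_choose
  refine ⟨Y, by linarith, fun σ τ hσ hτ => ?_⟩
  have h := C3A.main_prod a0 an (by linarith) (by linarith) (hY σ hσ).2 (hY τ hτ).1 (hY τ hτ).2
  exact h
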